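/- Every triangle-free simple graph on n vertices has at most 3^(n/3) maximal induced matchings. -/

import Mathlib

/-- An induced matching: a set of edges of `G`, pairwise disjoint, such that
no edge of `G` joins endpoints of two distinct edges of the matching. -/
def IsInducedMatching {V : Type*} (G : SimpleGraph V) (M : Finset (Sym2 V)) : Prop :=
  (∀ e ∈ M, e ∈ G.edgeSet) ∧
    ∀ e ∈ M, ∀ f ∈ M, e ≠ f → ∀ x ∈ e, ∀ y ∈ f, x ≠ y ∧ ¬ G.Adj x y

/-- `M` covers the vertex `v` if `v` is an endpoint of an edge of `M`. -/
def MCovers {V : Type*} (M : Finset (Sym2 V)) (v : V) : Prop := ∃ e ∈ M, v ∈ e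

/-- A maximal induced matching. -/
def IsMaximalInducedMatching {V : Type*} (G : SimpleGraph V) (M : Finset (Sym2 V)) : Prop :=
  IsInducedMatching G M ∧ ∀ M', IsInducedMatching G M' → M ⊆ M' → M' = M

/-- The number of maximal induced matchings of `G`. -/
noncomputable def mimCount {V : Type*} (G : SimpleGraph V) : ℕ :=
  {M : Finset (Sym2 V) | IsMaximalInducedMatching G M}.ncard

namespace InducedMatching

open Finset

/-- The real number `3 ^ (-1/3)`. -/
noncomputable def rho : ℝ := (3 : ℝ) ^ (-(1 / 3) : ℝ)

theorem rho_pos : 0 < rho := Real.rpow_pos_of_pos (by norm_num) _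

theorem rho_pow_three : rho ^ 3 = 1 / 3 := by
  rw [rho, ← Real.rpow_natCast, ← Real.rpow_mul (by norm_num)]
  norm_num [Real.rpow_neg_one]

theorem rho_gt : 0.69336 < rho := by
  by_contra! h
  have := pow_le_pow_left₀ rho_pos.le h 3
  rw [rho_pow_three] at this
  norm_num at this

theorem rho_lt : rho < 0.69337 := by
  by_contra! h
  have := pow_le_pow_left₀ (by norm_num) h 3
  rw [rho_pow_three] at this
  norm_num at this

theorem rho_pow_anti {k n : ℕ} (h : k ≤ n) : rho ^ n ≤ rho ^ k :=
  pow_le_pow_of_le_one rho_pos.le (by linarith [rho_lt]) h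

theorem rho_sq_gt : 0.48074 < rho ^ 2 := by nlinarith [rho_gt]

theorem rho_sq_lt : rho ^ 2 < 0.48077 := by nlinarith [rho_lt, rho_pos]

theorem rho_pow_add_three (n : ℕ) : rho ^ (n + 3) = rho ^ n / 3 := by
  rw [pow_add, rho_pow_three]; ring

theorem rho_pow_four : rho ^ 4 = rho / 3 := by simpa using rho_pow_add_three 1

theorem rho_pow_five : rho ^ 5 = rho ^ 2 / 3 := rho_pow_add_three 2

theorem rho_pow_six : rho ^ 6 = 1 / 9 := by
  rw [rho_pow_add_three 3, rho_pow_three]; norm_num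

theorem rho_pow_seven : rho ^ 7 = rho / 9 := by
  rw [rho_pow_add_three 4, rho_pow_four]; ring

theorem rho_pow_eight : rho ^ 8 = rho ^ 2 / 9 := by
  rw [rho_pow_add_three 5, rho_pow_five]; ring

theorem rho_pow_nine : rho ^ 9 = 1 / 27 := by
  rw [rho_pow_add_three 6, rho_pow_six]; norm_num

theorem rho_pow_ten : rho ^ 10 = rho / 27 := by
  rw [rho_pow_add_three 7, rho_pow_seven]; ring

theorem rho_facts : rho ^ 3 = 1 / 3 ∧ rho ^ 4 = rho / 3 ∧ rho ^ 5 = rho ^ 2 / 3 ∧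
    rho ^ 6 = 1 / 9 ∧ rho ^ 7 = rho / 9 ∧ rho ^ 8 = rho ^ 2 / 9 ∧ rho ^ 9 = 1 / 27 ∧
    rho ^ 10 = rho / 27 ∧ 0.69336 < rho ∧ rho < 0.69337 ∧ 0.48074 < rho ^ 2 ∧
    rho ^ 2 < 0.48077 :=
  ⟨rho_pow_three, rho_pow_four, rho_pow_five, rho_pow_six, rho_pow_seven, rho_pow_eight,
    rho_pow_nine, rho_pow_ten, rho_gt, rho_lt, rho_sq_gt, rho_sq_lt⟩

theorem mul_rho_pow_anti {k n : ℕ} (hk : 3 ≤ k) (h : k ≤ n) : n * rho ^ n ≤ k * rho ^ k := by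
  induction n, h using Nat.le_induction with
  | base => exact le_rfl
  | succ n hn ih =>
    have h1 := rho_lt
    have h2 := rho_pos
    have h3 : (3 : ℝ) ≤ n := by exact_mod_cast hk.trans hn
    have h4 : 0 < rho ^ n := pow_pos h2 n
    calc ((n + 1 : ℕ) : ℝ) * rho ^ (n + 1) = ((n + 1) * rho) * rho ^ n := by
          push_cast; ring
      _ ≤ n * rho ^ n := by
          apply mul_le_mul_of_nonneg_right _ h4.le
          nlinarith
      _ ≤ _ := ih

theorem mul_rho_pow_le_one (n : ℕ) : n * rho ^ n ≤ 1 := by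
  rcases lt_or_ge n 3 with hn | hn
  · have h1 := rho_lt
    interval_cases n
    · norm_num
    · norm_num; linarith
    · norm_num; linarith [rho_sq_lt]
  · have := mul_rho_pow_anti le_rfl hn
    norm_num [rho_pow_three] at this
    exact this

theorem natCast_mul_rho_pow_add_le (n k : ℕ) : n * rho ^ (n + k) ≤ rho ^ k := by
  have := mul_le_mul_of_nonneg_right (mul_rho_pow_le_one n) (pow_pos rho_pos k).le
  rw [pow_add]
  linarith

theorem natCast_mul_rho_pow_le {n : ℕ} (k N : ℕ) (h : n + k ≤ N) : n * rho ^ N ≤ rho ^ k :=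
  (mul_le_mul_of_nonneg_left (rho_pow_anti h) (Nat.cast_nonneg n)).trans
    (natCast_mul_rho_pow_add_le n k)

/-- The inequalities satisfied by the normalised weighted number `m U` of maximal induced
matchings avoiding `U`, in a vertex-weighted triangle-free graph that is a minimal candidate
for violating the bound. -/
structure BranchSystem (V : Type*) [DecidableEq V] where
  /-- The neighbourhood of a vertex. -/
  N : V → Finset V
  /-- The weight of a vertex. -/
  w : V → ℕ
  /-- The normalised count of maximal induced matchings covering no vertex of a set. -/
  m : Finset V → ℝ
  symm : ∀ u v, u ∈ N v → v ∈ N u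
  triangle : ∀ u v z, u ∈ N v → z ∈ N u → z ∉ N v
  w_pos : ∀ v, 0 < w v
  separated : ∀ u v, u ≠ v → v ∉ N u →
    ∃ s ∈ N u, ∃ t ∈ N v, s ≠ t ∧ s ∉ N v ∧ t ∉ N u ∧ s ∉ N t
  branch : ∀ v U, m U ≤ m (insert v U) +
    ∑ u ∈ N v \ U, (w v : ℝ) * w u * rho ^ (∑ i ∈ N u ∪ N v ∪ U, w i)
  blocked : ∀ u v U, u ∈ N v → N u ⊆ U → N v ⊆ U → m U ≤ 0
  bound : ∀ U, U.Nonempty → m U ≤ rho ^ (∑ i ∈ U, w i)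

namespace BranchSystem

variable {V : Type*} [DecidableEq V] (B : BranchSystem V)

/-- The weighted degree. -/
def d (v : V) : ℕ := ∑ u ∈ B.N v, B.w u

/-- The weight removed when the edge `u v` is put into the matching and `U` is left uncovered. -/
def e (u v : V) (U : Finset V) : ℕ := ∑ i ∈ B.N u ∪ B.N v ∪ U, B.w i

variable {B} {u v x a b c : V} {U T : Finset V} {k t : ℕ}

theorem irrefl (v : V) : v ∉ B.N v := fun h => B.triangle v v v h h h

theorem add_le_e_of_subset (hu : u ∈ B.N v) (hT : T ⊆ U)
    (hd : ∀ a ∈ T, a ∉ B.N u ∧ a ∉ B.N v) :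
    B.d u + B.d v + ∑ a ∈ T, B.w a ≤ B.e u v U := by
  unfold d e
  have h1 : Disjoint (B.N u) (B.N v) :=
    Finset.disjoint_left.2 fun z hz => B.triangle u v z hu hz
  have h2 : Disjoint (B.N u ∪ B.N v) T := by
    refine Finset.disjoint_right.2 fun a ha => ?_
    have := hd a ha
    simp [this.1, this.2]
  rw [← Finset.sum_union h1, ← Finset.sum_union h2]
  exact Finset.sum_le_sum_of_subset (Finset.union_subset_union_right hT)

theorem add_le_e (hu : u ∈ B.N v) : B.d u + B.d v ≤ B.e u v U := by
  simpa using add_le_e_of_subset (T := ∅) (U := U) hu (by simp) (by simp)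

theorem add_le_e₁ (hu : u ∈ B.N v) (ha : a ∈ U) (ha' : a ∉ B.N u ∧ a ∉ B.N v) :
    B.d u + B.d v + B.w a ≤ B.e u v U := by
  simpa using add_le_e_of_subset (T := {a}) (U := U) hu (by simpa) (by simpa)

theorem add_le_e₂ (hu : u ∈ B.N v) (ha : a ∈ U ∧ b ∈ U) (hab : a ≠ b)
    (ha' : a ∉ B.N u ∧ a ∉ B.N v) (hb' : b ∉ B.N u ∧ b ∉ B.N v) :
    B.d u + B.d v + B.w a + B.w b ≤ B.e u v U := by
  have := add_le_e_of_subset (T := {a, b}) (U := U) hu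
    (by simp [Finset.insert_subset_iff, ha]) (by simp [ha', hb'])
  rw [Finset.sum_pair hab] at this
  omega

theorem add_le_e₃ (hu : u ∈ B.N v) (ha : a ∈ U ∧ b ∈ U ∧ c ∈ U)
    (hab : a ≠ b ∧ a ≠ c ∧ b ≠ c) (ha' : a ∉ B.N u ∧ a ∉ B.N v)
    (hb' : b ∉ B.N u ∧ b ∉ B.N v) (hc' : c ∉ B.N u ∧ c ∉ B.N v) :
    B.d u + B.d v + B.w a + B.w b + B.w c ≤ B.e u v U := by
  have := add_le_e_of_subset (T := {a, b, c}) (U := U) hu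
    (by simp [Finset.insert_subset_iff, ha]) (by simp [ha', hb', hc'])
  rw [Finset.sum_insert (by simp [hab]), Finset.sum_pair hab.2.2] at this
  omega

theorem branch_of_le (v : V) (U A : Finset V) (f : V → ℕ) (hA : ∀ u ∈ B.N v, u ∉ U → u ∈ A)
    (hf : ∀ u ∈ B.N v, u ∉ U → f u ≤ B.e u v U) :
    B.m U ≤ B.m (insert v U) + ∑ u ∈ A, (B.w v : ℝ) * B.w u * rho ^ f u := by
  refine (B.branch v U).trans (add_le_add le_rfl ?_)
  calc _ ≤ ∑ u ∈ B.N v \ U, (B.w v : ℝ) * B.w u * rho ^ f u := by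
        refine Finset.sum_le_sum fun u hu => ?_
        rw [Finset.mem_sdiff] at hu
        exact mul_le_mul_of_nonneg_left (rho_pow_anti (hf u hu.1 hu.2)) (by positivity)
    _ ≤ _ := by
        refine Finset.sum_le_sum_of_subset_of_nonneg (fun u hu => ?_) fun u _ _ => ?_
        · rw [Finset.mem_sdiff] at hu
          exact hA u hu.1 hu.2
        · have := rho_pos
          positivity

/-- Branching at `v` when `a` is its only neighbour outside `U`. -/
theorem branch_one (a : V) (k : ℕ) (hN : ∀ u ∈ B.N v, u ∉ U → u = a) (hk : k ≤ B.e a v U) :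
    B.m U ≤ B.m (insert v U) + B.w v * B.w a * rho ^ k := by
  simpa using branch_of_le (B := B) v U {a} (fun _ => k) (by simpa using hN)
    (fun u hu hu' => by rw [hN u hu hu']; exact hk)

/-- Branching at `v` when `a` and `b` are its only neighbours outside `U`. -/
theorem branch_two (a b : V) (k l : ℕ) (hab : a ≠ b) (hN : ∀ u ∈ B.N v, u ∉ U → u = a ∨ u = b)
    (hk : k ≤ B.e a v U) (hl : l ≤ B.e b v U) :
    B.m U ≤ B.m (insert v U) + (B.w v * B.w a * rho ^ k + B.w v * B.w b * rho ^ l) := by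
  have := branch_of_le (B := B) v U {a, b} (fun u => if u = a then k else l) (by simpa using hN)
    (fun u hu hu' => by
      rcases hN u hu hu' with rfl | rfl
      · simpa using hk
      · simpa [hab.symm] using hl)
  rw [Finset.sum_pair hab] at this
  simpa [hab.symm] using this

/-- Branching at `v` when `a`, `b` and `c` are its only neighbours outside `U`. -/
theorem branch_three (a b c : V) (k l n : ℕ) (hab : a ≠ b ∧ a ≠ c ∧ b ≠ c)
    (hN : ∀ u ∈ B.N v, u ∉ U → u = a ∨ u = b ∨ u = c)
    (hk : k ≤ B.e a v U) (hl : l ≤ B.e b v U) (hn : n ≤ B.e c v U) :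
    B.m U ≤ B.m (insert v U) + (B.w v * B.w a * rho ^ k + B.w v * B.w b * rho ^ l +
      B.w v * B.w c * rho ^ n) := by
  have := branch_of_le (B := B) v U {a, b, c}
    (fun u => if u = a then k else if u = b then l else n) (by simpa using hN)
    (fun u hu hu' => by
      rcases hN u hu hu' with rfl | rfl | rfl
      · simpa using hk
      · simpa [hab.1.symm] using hl
      · simpa [hab.2.1.symm, hab.2.2.symm] using hn)
  rw [Finset.sum_insert (by simp [hab]), Finset.sum_pair hab.2.2] at this
  simp only [if_true, hab.1.symm, hab.2.1.symm, hab.2.2.symm, if_false] at this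
  linarith

/-- Branching at `v` with a common exponent for all its neighbours outside `T ⊆ U`. -/
theorem branch_uniform (v : V) (T : Finset V) (t k : ℕ) (hT : T ⊆ U) (hTN : T ⊆ B.N v)
    (ht : t + ∑ a ∈ T, B.w a = B.d v) (hk : ∀ u ∈ B.N v, u ∉ U → k ≤ B.e u v U) :
    B.m U ≤ B.m (insert v U) + B.w v * t * rho ^ k := by
  have h := branch_of_le (B := B) v U (B.N v \ T) (fun _ => k)
    (fun u hu hu' => Finset.mem_sdiff.2 ⟨hu, fun h => hu' (hT h)⟩) hk
  have h2 : ∑ u ∈ B.N v \ T, B.w u = t := by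
    have := Finset.sum_sdiff (f := B.w) hTN
    unfold d at ht
    omega
  rw [← Finset.sum_mul, ← Finset.mul_sum, ← Nat.cast_sum, h2] at h
  exact h

/-- Branching at `v` with a common exponent for all its neighbours outside `T ⊆ U`, except
that one of them has a larger exponent. -/
theorem branch_special (v : V) (T : Finset V) (a : V) (t k : ℕ) (hTU : T ⊆ U) (hT : T ⊆ B.N v)
    (ha : a ∈ B.N v) (haT : a ∉ T) (ht : t + 1 + ∑ x ∈ T, B.w x = B.d v)
    (hk : ∀ u ∈ B.N v, u ∉ U → k ≤ B.e u v U) (hka : a ∉ U → k + 1 ≤ B.e a v U) :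
    B.m U ≤ B.m (insert v U) + B.w v * (t * rho ^ k + rho ^ (k + 1)) := by
  have h := branch_of_le (B := B) v U (B.N v \ T) (fun u => if u = a then k + 1 else k)
    (fun u hu hu' => Finset.mem_sdiff.2 ⟨hu, fun h => hu' (hTU h)⟩)
    (fun u hu hu' => by
      split_ifs with h
      · subst h; exact hka hu'
      · exact hk u hu hu')
  refine h.trans (add_le_add le_rfl ?_)
  have haA : a ∈ B.N v \ T := by simp [ha, haT]
  have h2 : B.w a + ∑ u ∈ (B.N v \ T).erase a, B.w u = t + 1 := by
    rw [Finset.add_sum_erase _ _ haA]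
    have := Finset.sum_sdiff (f := B.w) hT
    unfold d at ht
    omega
  rw [← Finset.add_sum_erase _ _ haA]
  have h3 : ∑ u ∈ (B.N v \ T).erase a, (B.w v : ℝ) * B.w u * rho ^ (if u = a then k + 1 else k)
      = B.w v * (((t + 1 : ℕ) : ℝ) - B.w a) * rho ^ k := by
    rw [← h2]
    push_cast
    rw [add_sub_cancel_left, Finset.mul_sum, Finset.sum_mul]
    refine Finset.sum_congr rfl fun u hu => ?_
    rw [if_neg (Finset.ne_of_mem_erase hu)]
  rw [h3, if_pos rfl]
  have h4 : (1 : ℝ) ≤ B.w a := by exact_mod_cast B.w_pos a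
  have h5 : (0 : ℝ) ≤ B.w v := by positivity
  have h6 : rho ^ (k + 1) ≤ rho ^ k := rho_pow_anti (Nat.le_succ k)
  have h7 : 0 ≤ B.w v * ((B.w a - 1 : ℝ) * (rho ^ k - rho ^ (k + 1))) :=
    mul_nonneg h5 (mul_nonneg (by linarith) (by linarith))
  push_cast
  nlinarith

theorem m_empty_le_of_le {r : ℝ} (h : B.m ∅ ≤ B.m {v} + r) : B.m ∅ ≤ rho ^ B.w v + r := by
  have h2 := B.bound {v} (by simp)
  rw [Finset.sum_singleton] at h2
  linarith

/-- Branching at a single vertex, bounding the two parts by their weights. -/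
theorem simple_uniform (v : V) (k : ℕ) (hk : ∀ u ∈ B.N v, k ≤ B.d u) :
    B.m ∅ ≤ rho ^ B.w v + B.w v * B.d v * rho ^ (B.d v + k) :=
  m_empty_le_of_le (branch_uniform (B := B) (U := ∅) v ∅ (B.d v) (B.d v + k) (by simp) (by simp)
    (by simp) (fun u hu _ => by
      have := hk u hu
      have := add_le_e (U := ∅) hu
      omega))

theorem simple_special (v : V) (a : V) (t k : ℕ) (ha : a ∈ B.N v) (ht : t + 1 = B.d v)
    (hk : ∀ u ∈ B.N v, k ≤ B.d u) (hka : k + 1 ≤ B.d a) :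
    B.m ∅ ≤ rho ^ B.w v + B.w v * (t * rho ^ (B.d v + k) + rho ^ (B.d v + k + 1)) :=
  m_empty_le_of_le (branch_special (B := B) (U := ∅) v ∅ a t (B.d v + k) (by simp) (by simp)
    ha (by simp) (by simpa) (fun u hu _ => by
      have := hk u hu
      have := add_le_e (U := ∅) hu
      omega) (fun _ => by
      have := add_le_e (U := ∅) ha
      omega))

theorem simple_pair (a b : V) (k l : ℕ) (hab : a ≠ b) (ha : a ∈ B.N v) (hb : b ∈ B.N v)
    (hN : ∀ u ∈ B.N v, u = a ∨ u = b) (hk : k ≤ B.d a) (hl : l ≤ B.d b) :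
    B.m ∅ ≤ rho ^ B.w v + (B.w v * B.w a * rho ^ (B.d v + k) +
      B.w v * B.w b * rho ^ (B.d v + l)) :=
  m_empty_le_of_le (branch_two (B := B) (U := ∅) a b _ _ hab (fun u hu _ => hN u hu)
    (by have := add_le_e (U := ∅) ha; omega) (by have := add_le_e (U := ∅) hb; omega))

theorem w_le_d (h : u ∈ B.N v) : B.w u ≤ B.d v := by
  simpa [d] using Finset.sum_le_sum_of_subset (f := B.w) (Finset.singleton_subset_iff.2 h)

theorem eq_of_d_le (hT : T ⊆ B.N v) (h : B.d v ≤ ∑ a ∈ T, B.w a) : ∀ u, u ∈ B.N v → u ∈ T := by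
  intro u hu
  by_contra hu'
  have := Finset.sum_le_sum_of_subset (f := B.w) (Finset.insert_subset hu hT)
  rw [Finset.sum_insert hu'] at this
  have := B.w_pos u
  unfold d at h
  omega

theorem pair_le_d (ha : a ∈ B.N v) (hb : b ∈ B.N v) (hab : a ≠ b) : B.w a + B.w b ≤ B.d v := by
  have := Finset.sum_le_sum_of_subset (f := B.w) (Finset.insert_subset ha
    (Finset.singleton_subset_iff.2 hb))
  rwa [Finset.sum_pair hab] at this

theorem triple_le_d (ha : a ∈ B.N v) (hb : b ∈ B.N v) (hc : c ∈ B.N v)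
    (hab : a ≠ b ∧ a ≠ c ∧ b ≠ c) : B.w a + B.w b + B.w c ≤ B.d v := by
  have := Finset.sum_le_sum_of_subset (f := B.w) (Finset.insert_subset ha (Finset.insert_subset hb
    (Finset.singleton_subset_iff.2 hc)))
  rw [Finset.sum_insert (by simp [hab]), Finset.sum_pair hab.2.2] at this
  unfold d
  omega

theorem mem_pair_of_d_le (ha : a ∈ B.N v) (hb : b ∈ B.N v) (hab : a ≠ b)
    (h : B.d v ≤ B.w a + B.w b) : ∀ u, u ∈ B.N v → u = a ∨ u = b := by
  simpa using eq_of_d_le (B := B) (T := {a, b}) (by simp [Finset.insert_subset_iff, ha, hb])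
    (by rwa [Finset.sum_pair hab])

theorem mem_triple_of_d_le (ha : a ∈ B.N v) (hb : b ∈ B.N v) (hc : c ∈ B.N v)
    (hab : a ≠ b ∧ a ≠ c ∧ b ≠ c) (h : B.d v ≤ B.w a + B.w b + B.w c) :
    ∀ u, u ∈ B.N v → u = a ∨ u = b ∨ u = c := by
  simpa using eq_of_d_le (B := B) (T := {a, b, c})
    (by simp [Finset.insert_subset_iff, ha, hb, hc])
    (by rw [Finset.sum_insert (by simp [hab]), Finset.sum_pair hab.2.2]; omega)

theorem d_eq_pair (ha : a ∈ B.N v) (hb : b ∈ B.N v) (hab : a ≠ b)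
    (h : ∀ u, u ∈ B.N v → u = a ∨ u = b) : B.d v = B.w a + B.w b := by
  rw [d, show B.N v = {a, b} by ext u; simp; exact ⟨h u, by rintro (rfl | rfl) <;> assumption⟩,
    Finset.sum_pair hab]

theorem exists_ne (ha : a ∈ B.N v) (h : B.w a < B.d v) : ∃ b ∈ B.N v, b ≠ a := by
  by_contra! h'
  have : B.N v = {a} := by ext u; simp; exact ⟨h' u, by rintro rfl; assumption⟩
  rw [d, this, Finset.sum_singleton] at h
  exact lt_irrefl _ h

theorem exists_third (ha : a ∈ B.N v) (hb : b ∈ B.N v) (hab : a ≠ b)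
    (h : B.w a + B.w b < B.d v) : ∃ c ∈ B.N v, c ≠ a ∧ c ≠ b := by
  by_contra! h'
  have := d_eq_pair ha hb hab (fun u hu => by
    by_contra! hne
    exact hne.2 (h' u hu hne.1))
  omega

theorem exists_mem_notMem (huv : u ≠ v) (hv : v ∉ B.N u) : ∃ s ∈ B.N u, s ∉ B.N v := by
  obtain ⟨s, hs, -, -, -, hs', -⟩ := B.separated u v huv hv
  exact ⟨s, hs, hs'⟩

theorem exists_two (h : 1 < B.m ∅) (v : V) : ∃ a ∈ B.N v, ∃ b ∈ B.N v, a ≠ b := by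
  by_contra! hN
  have hr : ∀ k, rho ^ k ≤ 1 := fun k => by simpa using rho_pow_anti (Nat.zero_le k)
  rcases (B.N v).eq_empty_or_nonempty with h0 | ⟨u, hu⟩
  · have h1 := branch_of_le (B := B) v ∅ ∅ (fun _ => 0) (by simp [h0]) (by simp)
    have h2 := B.bound {v} (by simp)
    have := hr (B.w v)
    simp at h1 h2
    linarith
  · have hNv : ∀ z, z ∈ B.N v → z = u := fun z hz => hN z hz u hu
    have hNu : ∀ z, z ∈ B.N u → z = v := by
      intro z hz
      by_contra hzv
      obtain ⟨s, hs, hs'⟩ := exists_mem_notMem (B := B) (u := v) (v := z) (Ne.symm hzv)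
        (B.triangle u v z hu hz)
      rw [hNv s hs] at hs'
      exact hs' (B.symm _ _ hz)
    have h1 := branch_one (B := B) (v := v) (U := ∅) u (B.w v + B.w u)
      (fun z hz _ => hNv z hz) (by
        have h2 := add_le_e (B := B) (U := ∅) hu
        have h3 := w_le_d (B := B) hu
        have h4 := w_le_d (B := B) (B.symm _ _ hu)
        omega)
    have h2 := branch_of_le (B := B) u {v} ∅ (fun _ => 0)
      (by simpa using hNu) (fun z hz hz' => absurd (by simpa using hNu z hz) hz')
    have h3 := B.blocked u v {u, v} hu (fun z hz => by simp [hNu z hz])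
      (fun z hz => by simp [hNv z hz])
    have h4 := mul_le_mul (mul_rho_pow_le_one (B.w v)) (mul_rho_pow_le_one (B.w u))
      (mul_nonneg (Nat.cast_nonneg _) (pow_nonneg rho_pos.le _)) zero_le_one
    simp at h1 h2
    rw [pow_add] at h1
    linarith

theorem two_le_d (h : 1 < B.m ∅) (v : V) : 2 ≤ B.d v := by
  obtain ⟨a, ha, b, hb, hab⟩ := exists_two h v
  have := pair_le_d ha hb hab
  have := B.w_pos a
  have := B.w_pos b
  omega

theorem w_lt_d (h : 1 < B.m ∅) (hu : u ∈ B.N v) : B.w u < B.d v := by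
  obtain ⟨a, ha, b, hb, hab⟩ := exists_two h v
  have : ∃ z ∈ B.N v, z ≠ u := by
    by_cases hau : a = u
    · exact ⟨b, hb, fun hbu => hab (hau.trans hbu.symm)⟩
    · exact ⟨a, ha, hau⟩
  obtain ⟨z, hz, hzu⟩ := this
  have := pair_le_d hz hu hzu
  have := B.w_pos z
  omega

/-- A vertex of degree two cannot have a neighbour whose only other neighbour has weight one. -/
theorem no_chain (h : 1 < B.m ∅) {v x y x' : V} (hv : ∀ u, u ∈ B.N v → u = x ∨ u = y)
    (hx : x ∈ B.N v) (hy : y ∈ B.N v) (hxy : x ≠ y) (hxN : ∀ u, u ∈ B.N x → u = v ∨ u = x')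
    (hx' : x' ∈ B.N x) (hne : x' ≠ v) (wx : B.w x = 1) (wy : B.w y = 1) (wx' : B.w x' = 1)
    (wv : B.w v = 1 ∨ B.w v = 2) : False := by
  have hvx := B.symm _ _ hx
  have hvy := B.symm _ _ hy
  have hxx' := B.symm _ _ hx'
  have hyx : y ∉ B.N x := fun hh => B.triangle _ _ _ hx hh hy
  obtain ⟨s, hs, t, ht, hst, hsy, htx, hsN⟩ := B.separated x y hxy hyx
  obtain rfl : s = x' := by grind
  have dv : B.d v = 2 := by rw [d_eq_pair hx hy hxy hv]; omega
  have dx : B.d x = B.w v + 1 := by rw [d_eq_pair hvx hs hne.symm hxN]; omega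
  have hsv : s ∉ B.N v := fun hh => B.triangle _ _ _ hx hs hh
  have hvs : v ∉ B.N s := fun hh => hsv (B.symm _ _ hh)
  have dy := w_lt_d h hvy
  have ds := two_le_d h s
  obtain ⟨p, hp⟩ : ∃ p, B.d y = p + 1 + B.w v := ⟨B.d y - 1 - B.w v, by omega⟩
  obtain ⟨q, hq⟩ : ∃ q, B.d s = q + 2 := ⟨B.d s - 2, by omega⟩
  have c1 := branch_two (B := B) (v := v) (U := ∅) x y (B.w v + 3) (2 + B.d y) hxy
    (fun u hu _ => hv u hu) (by have := add_le_e (U := ∅) hx; omega)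
    (by have := add_le_e (U := ∅) hy; omega)
  have c2 := branch_one (B := B) (v := x) (U := {v}) s (B.w v + 1 + B.d s)
    (by simp; grind) (by have := add_le_e (U := {v}) hs; omega)
  have c3 := branch_uniform (B := B) (U := {x, v}) y {v} (p + 1) (B.d y + 3) (by simp)
    (by simpa) (by simp; omega) (fun u hu hu' => by
      have := add_le_e₁ (B := B) (U := {x, v}) (a := x) hu (by simp) (by grind [B.symm])
      have := two_le_d h u
      omega)
  have c5 := B.blocked x v {s, y, x, v} hx (by grind) (by grind)
  have key : (∀ u ∈ B.N s, u ≠ x → y ∉ B.N u) →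
      B.m {y, x, v} ≤ B.m {s, y, x, v} + B.w s * ((q + 1 : ℕ) : ℝ) * rho ^ (B.d s + 3 + B.w v) := by
    intro hk
    refine branch_uniform (B := B) (U := {y, x, v}) s {x} (q + 1) _ (by simp)
      (by simpa) (by simp; omega) (fun u hu hu' => ?_)
    have := add_le_e₂ (B := B) (U := {y, x, v}) (a := v) (b := y) hu (by simp)
      (by grind [B.irrefl]) (by grind [B.symm]) (by grind [B.symm])
    have := two_le_d h u
    omega
  have c4 := branch_uniform (B := B) (U := {y, x, v}) s {x} (q + 1) (B.d s + 2 + B.w v) (by simp)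
      (by simpa) (by simp; omega) (fun u hu hu' => by
    have := add_le_e₁ (B := B) (U := {y, x, v}) (a := v) hu (by simp) (by grind [B.symm])
    have := two_le_d h u
    omega)
  have ky : p = 0 → ∀ u ∈ B.N s, u ≠ x → y ∉ B.N u := by
    intro hp0 u hu hux hyu
    have hyN := mem_pair_of_d_le (B := B) (v := y) hvy ht (by grind)
      (by have := B.w_pos t; omega)
    rcases hyN u (B.symm _ _ hyu) with rfl | rfl
    · exact hvs hu
    · exact hsN (B.symm _ _ hu)
  have ks : q = 0 → ∀ u ∈ B.N s, u ≠ x → y ∉ B.N u := by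
    intro hq0 u hu hux hyu
    have hsN' := mem_pair_of_d_le (B := B) (v := s) hxx' hu hux.symm
      (by have := B.w_pos u; omega)
    obtain ⟨s', hs', t', ht', h1, h2, h3, h4⟩ := B.separated s v hne hvs
    have : s' = u := by grind
    have : t' = y := by grind
    subst_vars
    exact h4 (B.symm _ _ hyu)
  simp only [wx, wy, wx', hp, hq, insert_empty_eq] at c1 c2 c3 c4 key
  obtain ⟨r3, r4, r5, r6, r7, r8, r9, r10, r1, r1', r2, r2'⟩ := rho_facts
  push_cast at c1 c2 c3 c4 key
  rcases wv with wv | wv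
  · simp only [wv] at c1 c2 c3 c4 key
    have F0 : p = 0 ∨ rho ^ (p + 4) + (p + 1) * rho ^ (p + 5) ≤ 0.3826 := by
      rcases lt_or_ge p 3 with hp3 | hp3
      · interval_cases p <;> norm_num <;> linarith
      · have h1 := natCast_mul_rho_pow_le (n := p + 1) 4 (p + 5) (by omega)
        have h2 := rho_pow_anti (k := 7) (n := p + 4) (by omega)
        push_cast at h1
        right; linarith
    have F1 : q = 0 ∨ q = 1 ∨ rho ^ (q + 4) + (q + 1) * rho ^ (q + 5) ≤ 0.343 := by
      rcases lt_or_ge q 3 with hp3 | hp3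
      · interval_cases q <;> norm_num
        linarith
      · have h1 := natCast_mul_rho_pow_le (n := q + 1) 4 (q + 5) (by omega)
        have h2 := rho_pow_anti (k := 7) (n := q + 4) (by omega)
        push_cast at h1
        right; right; linarith
    ring_nf at c1 c2 c3 c4 key F0 F1
    rcases F0 with rfl | F0 <;> rcases F1 with rfl | rfl | F1 <;> norm_num at * <;>
      first
      | linarith
      | (have := key ks; linarith)
      | (have := key ky; linarith)
  · simp only [wv] at c1 c2 c3 c4 key
    have F0 : p = 0 ∨ 2 * rho ^ (p + 5) + (p + 1) * rho ^ (p + 6) ≤ 0.3765 := by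
      rcases lt_or_ge p 3 with hp3 | hp3
      · interval_cases p <;> norm_num <;> linarith
      · have h1 := natCast_mul_rho_pow_le (n := p + 1) 5 (p + 6) (by omega)
        have h2 := rho_pow_anti (k := 8) (n := p + 5) (by omega)
        push_cast at h1
        right; linarith
    have F1 : rho ^ (q + 5) + (q + 1) * rho ^ (q + 7) ≤ 0.24 := by
      rcases lt_or_ge q 2 with hp3 | hp3
      · interval_cases q <;> norm_num <;> linarith
      · have h1 := natCast_mul_rho_pow_le (n := q + 1) 6 (q + 7) (by omega)
        have h2 := rho_pow_anti (k := 7) (n := q + 5) (by omega)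
        push_cast at h1
        linarith
    have F2 : rho ^ (q + 5) + (q + 1) * rho ^ (q + 6) ≤ 0.272 := by
      rcases lt_or_ge q 3 with hp3 | hp3
      · interval_cases q <;> norm_num <;> linarith
      · have h1 := natCast_mul_rho_pow_le (n := q + 1) 5 (q + 6) (by omega)
        have h2 := rho_pow_anti (k := 8) (n := q + 5) (by omega)
        push_cast at h1
        linarith
    ring_nf at c1 c2 c3 c4 key F0 F1 F2
    rcases F0 with rfl | F0
    · have := key (ky rfl)
      norm_num at *
      linarith
    · linarith

/-- The structure of the neighbourhood of a vertex of degree two. -/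
theorem of_d_eq_two (h : 1 < B.m ∅) (hd : B.d v = 2) : B.w v = 1 ∧ ∃ x ∈ B.N v, ∃ y ∈ B.N v,
    x ≠ y ∧ (∀ u ∈ B.N v, u = x ∨ u = y) ∧ B.w x = 1 ∧ B.w y = 1 ∧ B.d x = 3 ∧ B.d y = 3 := by
  obtain ⟨x, hx, y, hy, hxy⟩ := exists_two h v
  have hle := pair_le_d hx hy hxy
  have wx : B.w x = 1 := by have := B.w_pos x; have := B.w_pos y; omega
  have wy : B.w y = 1 := by have := B.w_pos x; have := B.w_pos y; omega
  have hN := mem_pair_of_d_le hx hy hxy (by omega)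
  have hvx := B.symm _ _ hx
  have hvy := B.symm _ _ hy
  have dx := w_lt_d h hvx
  have dy := w_lt_d h hvy
  have chain : ∀ {x y}, (∀ u, u ∈ B.N v → u = x ∨ u = y) → x ∈ B.N v → y ∈ B.N v → x ≠ y →
      B.w x = 1 → B.w y = 1 → B.w v = 1 ∨ B.w v = 2 → B.w v < B.d x → B.d x ≠ B.w v + 1 := by
    intro x y hN hx hy hxy wx wy wv dx hdx
    have hvx := B.symm _ _ hx
    obtain ⟨s, hs, hsv⟩ := exists_ne hvx dx
    have := pair_le_d hvx hs hsv.symm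
    have := B.w_pos s
    exact no_chain h hN hx hy hxy (mem_pair_of_d_le hvx hs hsv.symm (by omega)) hs hsv wx wy
      (by omega) wv
  have cx := chain hN hx hy hxy wx wy
  have cy := chain (fun u hu => (hN u hu).symm) hy hx hxy.symm wy wx
  obtain ⟨r3, r4, r5, r6, r7, r8, r9, r10, r1, r1', r2, r2'⟩ := rho_facts
  have sb := fun k l => simple_pair (B := B) x y k l hxy hx hy hN
  simp only [wx, wy, hd, Nat.cast_one, mul_one] at sb
  rcases lt_or_ge (B.w v) 3 with hw | hw
  · obtain wv | wv : B.w v = 1 ∨ B.w v = 2 := by have := B.w_pos v; omega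
    · rw [wv] at sb dx dy cx cy ⊢
      refine ⟨rfl, x, hx, y, hy, hxy, hN, wx, wy, ?_⟩
      by_contra hne
      rcases lt_or_ge 3 (B.d x) with h4 | h4
      · have := sb 4 3 (by omega) (by omega)
        norm_num at this
        linarith
      · have := sb 3 4 (by omega) (by omega)
        norm_num at this
        linarith
    · rw [wv] at sb dx dy cx cy ⊢
      have := sb 4 4 (by omega) (by omega)
      norm_num at this
      linarith
  · have h1 := sb (B.w v + 1) (B.w v + 1) (by omega) (by omega)
    have h2 := natCast_mul_rho_pow_le (n := B.w v) 3 (2 + (B.w v + 1)) (by omega)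
    have h3 := rho_pow_anti hw
    linarith

/-- A vertex has at most one neighbour of degree two. -/
theorem d_two_unique (h : 1 < B.m ∅) {v p x : V} (hv : v ∈ B.N x) (hp : p ∈ B.N x)
    (hd : B.d v = 2) (hdp : B.d p = 2) : v = p := by
  by_contra hvp
  obtain ⟨wv, y₁, hy₁, y₂, hy₂, hy, hNv, wy₁, wy₂, dy₁, dy₂⟩ := of_d_eq_two h hd
  obtain ⟨y, hxy, hyv, hNv, wy, dy, wx, dx⟩ : ∃ y, x ≠ y ∧ y ∈ B.N v ∧
      (∀ u ∈ B.N v, u = x ∨ u = y) ∧ B.w y = 1 ∧ B.d y = 3 ∧ B.w x = 1 ∧ B.d x = 3 := by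
    rcases hNv x (B.symm _ _ hv) with rfl | rfl
    · exact ⟨y₂, hy, hy₂, hNv, wy₂, dy₂, wy₁, dy₁⟩
    · exact ⟨y₁, hy.symm, hy₁, fun u hu => (hNv u hu).symm, wy₁, dy₁, wy₂, dy₂⟩
  clear hy₁ hy₂ hy wy₁ wy₂ dy₁ dy₂
  obtain ⟨wp, y₁, hy₁, y₂, hy₂, hy, hNp, wy₁, wy₂, dy₁, dy₂⟩ := of_d_eq_two h hdp
  obtain ⟨z, hxz, hzp, hNp, wz, dz⟩ : ∃ z, x ≠ z ∧ z ∈ B.N p ∧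
      (∀ u ∈ B.N p, u = x ∨ u = z) ∧ B.w z = 1 ∧ B.d z = 3 := by
    rcases hNp x (B.symm _ _ hp) with rfl | rfl
    · exact ⟨y₂, hy, hy₂, hNp, wy₂, dy₂⟩
    · exact ⟨y₁, hy.symm, hy₁, fun u hu => (hNp u hu).symm, wy₁, dy₁⟩
  clear hy₁ hy₂ hy wy₁ wy₂ dy₁ dy₂
  have hpv : p ∉ B.N v := fun hh => B.triangle _ _ _ hv hh hp
  obtain ⟨s, hs, t, ht, hst, hsp, htv, hsN⟩ := B.separated v p hvp hpv
  obtain ⟨q, hq, hqv, hqp⟩ := exists_third hv hp hvp (by omega)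
  have hNx := mem_triple_of_d_le hv hp hq ⟨hvp, hqv.symm, hqp.symm⟩
    (by have := triple_le_d hv hp hq ⟨hvp, hqv.symm, hqp.symm⟩; have := B.w_pos q; omega)
  have wq : B.w q = 1 := by
    have := triple_le_d hv hp hq ⟨hvp, hqv.symm, hqp.symm⟩; have := B.w_pos q; omega
  have hxv := B.symm _ _ hv
  have hxp := B.symm _ _ hp
  have hxq := B.symm _ _ hq
  have hvy := B.symm _ _ hyv
  have hpz := B.symm _ _ hzp
  obtain rfl : y = s := by grind
  obtain rfl : z = t := by grind
  have dq := two_le_d h q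
  have c1 := branch_three (B := B) (v := x) (U := ∅) v p q 5 5 (3 + B.d q)
    ⟨hvp, hqv.symm, hqp.symm⟩ (fun u hu _ => hNx u hu)
    (by have := add_le_e (U := ∅) hv; omega) (by have := add_le_e (U := ∅) hp; omega)
    (by have := add_le_e (U := ∅) hq; omega)
  have c2 := branch_one (B := B) (v := v) (U := {x}) y 5 (by grind)
    (by have := add_le_e (U := {x}) hyv; omega)
  have c3 := branch_one (B := B) (v := p) (U := {v, x}) z 6 (by grind)
    (by have := add_le_e₁ (U := {v, x}) (a := v) hzp (by simp) (by grind [B.symm]); omega)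
  have c4 := branch_uniform (B := B) (U := {p, v, x}) q {x} (B.d q - 1) (B.d q + 4) (by simp)
    (by simpa) (by simp; omega) (fun u hu hu' => by
    have hvq : v ∉ B.N q := fun hh => B.triangle _ _ _ hq hh hv
    have hpq : p ∉ B.N q := fun hh => B.triangle _ _ _ hq hh hp
    by_cases huy : u = y
    · subst huy
      have := add_le_e₁ (B := B) (U := {p, v, x}) (a := p) hu (by simp) (by grind [B.symm])
      omega
    by_cases huz : u = z
    · subst huz
      have := add_le_e₁ (B := B) (U := {p, v, x}) (a := v) hu (by simp) (by grind [B.symm])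
      omega
    have := add_le_e₂ (B := B) (U := {p, v, x}) (a := v) (b := p) hu (by simp)
      hvp (by grind [B.symm]) (by grind [B.symm])
    have := two_le_d h u
    omega)
  have c6 := B.blocked x v {y, q, p, v, x} hxv (by grind) (by grind)
  have hyx : y ∉ B.N x := B.triangle _ _ _ hv hyv
  obtain ⟨l, hl⟩ : ∃ l, B.d q = l + 2 := ⟨B.d q - 2, by omega⟩
  have c5 : ∀ T ⊆ B.N y, T ⊆ {q, p, v, x} → ∀ t, t + ∑ a ∈ T, B.w a = 3 →
    B.m {q, p, v, x} ≤ B.m {y, q, p, v, x} + t * rho ^ 7 := by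
    intro T hT hT' t ht
    have := branch_uniform (B := B) (U := {q, p, v, x}) y T t 7 hT' hT (by omega)
      (fun u hu hu' => by
      have := add_le_e₂ (B := B) (U := {q, p, v, x}) (a := x) (b := p) hu (by simp)
        (by grind [B.irrefl]) (by grind [B.symm]) (by grind [B.symm])
      have := two_le_d h u
      omega)
    simpa [wy] using this
  have c5' := c5 {v} (by simpa) (by simp) 2 (by simp [wv])
  obtain ⟨r3, r4, r5, r6, r7, r8, r9, r10, r1, r1', r2, r2'⟩ := rho_facts
  rw [hl, Nat.add_sub_assoc (by norm_num)] at c4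
  rw [hl] at c1
  simp only [wv, wp, wq, wx, wy, wz, insert_empty_eq] at c1 c2 c3 c4
  push_cast at c1 c2 c3 c4 c5'
  rcases lt_or_ge l 2 with hl2 | hl2
  · interval_cases l
    · have hq2 : B.d q = 2 := hl
      obtain ⟨u, hu, hux⟩ := exists_ne (B := B) hxq (by omega)
      have hNq := mem_pair_of_d_le hxq hu hux.symm (by have := B.w_pos u; omega)
      have du : B.d u = 3 := by
        obtain ⟨-, a, ha, b, hb, hab, hN, wa, wb, da, db⟩ := of_d_eq_two h hq2
        rcases hN u hu with rfl | rfl <;> assumption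
      have hqv' : q ∉ B.N v := fun hh => B.triangle _ _ _ hv hh hq
      have hqp' : q ∉ B.N p := fun hh => B.triangle _ _ _ hp hh hq
      have hsv := B.separated v q hqv.symm hqv'
      have hsp := B.separated p q hqp.symm hqp'
      have hvu : v ∉ B.N u := by grind [B.symm]
      have hpu : p ∉ B.N u := by grind [B.symm]
      have c4' := branch_one (B := B) (v := q) (U := {p, v, x}) u 7 (by grind)
        (by
          have := add_le_e₂ (B := B) (U := {p, v, x}) (a := v) (b := p) hu (by simp)
            hvp (by grind [B.symm]) (by grind [B.symm])
          omega)
      have wu : B.w u = 1 := by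
        have := pair_le_d hxq hu hux.symm
        have := B.w_pos u
        omega
      rw [wq, wu] at c4'
      norm_num at *
      linarith
    · have hq3 : B.d q = 3 := hl
      by_cases hqy : q ∈ B.N y
      · have := c5 {v, q} (by simp [Finset.insert_subset_iff, hvy, hqy])
          (by simp [Finset.insert_subset_iff]) 1 (by rw [Finset.sum_pair hqv.symm]; omega)
        norm_num at *
        linarith
      · obtain ⟨a, ha, hav, ha3⟩ : ∃ a ∈ B.N y, a ≠ v ∧ (3 ≤ B.d a ∨ q ∉ B.N a) := by
          by_contra! hcon
          have w1 : ∀ a ∈ B.N y, a ≠ v → B.w a = 1 := by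
            intro a ha hav
            have := two_le_d h a
            exact (of_d_eq_two h (by have := (hcon a ha hav).1; omega)).1
          obtain ⟨a, ha, hav⟩ := exists_ne (B := B) hvy (by omega)
          obtain ⟨b, hb, hbv, hba⟩ := exists_third (B := B) hvy ha hav.symm
            (by have := w1 a ha hav; omega)
          have hsab := B.separated a b hba.symm
            (fun hh => B.triangle _ _ _ ha hh hb)
          have hNa := mem_pair_of_d_le (B.symm _ _ ha) (hcon a ha hav).2 (by grind)
            (by have := (hcon a ha hav).1; omega)
          have hyb := B.symm _ _ hb
          have hqb := (hcon b hb hbv).2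
          grind
        have := branch_special (B := B) (U := {q, p, v, x}) y {v} a 1 7 (by simp) (by simpa)
          ha (by simpa) (by simp; omega) (fun u hu hu' => by
            have := add_le_e₂ (B := B) (U := {q, p, v, x}) (a := x) (b := p) hu (by simp)
              (by grind [B.irrefl]) (by grind [B.symm]) (by grind [B.symm])
            have := two_le_d h u
            omega) (fun hu' => by
            rcases ha3 with ha3 | ha3
            · have := add_le_e₂ (B := B) (U := {q, p, v, x}) (a := x) (b := p) ha (by simp)
                (by grind [B.irrefl]) (by grind [B.symm]) (by grind [B.symm])
              omega
            · have := add_le_e₃ (B := B) (U := {q, p, v, x}) (a := x) (b := p) (c := q) ha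
                (by simp) (by grind [B.irrefl]) (by grind [B.symm]) (by grind [B.symm])
                (by grind [B.symm])
              have := two_le_d h a
              omega)
        rw [wy] at this
        norm_num at *
        linarith
  · have h1 := natCast_mul_rho_pow_le (n := l + 1) 5 (l + 2 + 4) (by omega)
    have h2 := rho_pow_anti (k := 7) (n := 3 + (l + 2)) (by omega)
    push_cast at h1
    norm_num at *
    linarith

/-- There are no vertices of degree two. -/
theorem three_le_d (h : 1 < B.m ∅) (v : V) : 3 ≤ B.d v := by
  by_contra hd3
  have hd : B.d v = 2 := by have := two_le_d h v; omega
  obtain ⟨wv, x, hx, y, hy, hxy, hNv, wx, wy, dx, dy⟩ := of_d_eq_two h hd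
  have hvx := B.symm _ _ hx
  have hvy := B.symm _ _ hy
  have hP : ∀ p ∈ B.N x, p ≠ v → 3 ≤ B.d p := by
    intro p hp hpv
    have := two_le_d h p
    by_contra hlt
    exact hpv (d_two_unique h hp hvx (by omega) hd)
  have hR : ∀ p ∈ B.N y, p ≠ v → 3 ≤ B.d p := by
    intro p hp hpv
    have := two_le_d h p
    by_contra hlt
    exact hpv (d_two_unique h hp hvy (by omega) hd)
  obtain ⟨r3, r4, r5, r6, r7, r8, r9, r10, r1, r1', r2, r2'⟩ := rho_facts
  have c1 := branch_two (B := B) (v := v) (U := ∅) x y 5 5 hxy (fun u hu _ => hNv u hu)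
    (by have := add_le_e (U := ∅) hx; omega) (by have := add_le_e (U := ∅) hy; omega)
  simp only [wv, wx, wy, insert_empty_eq] at c1
  have hP3 : ∀ p ∈ B.N x, p ≠ v → B.d p = 3 := by
    intro p hp hpv
    by_contra hne
    have := hP p hp hpv
    have c2 := branch_special (B := B) (U := {v}) x {v} p 1 6 (by simp) (by simpa) hp (by simpa)
      (by simp; omega) (fun u hu hu' => by
        have := hP u hu (by simpa using hu')
        have := add_le_e (U := {v}) hu
        omega) (fun _ => by
        have := add_le_e (U := {v}) hp
        omega)
    have c3 := B.bound {x, v} (by simp)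
    rw [Finset.sum_pair (by rintro rfl; exact irrefl _ hx), wx, wv] at c3
    rw [wx] at c2
    norm_num at c1 c2 c3
    linarith
  have c2 := branch_uniform (B := B) (U := {v}) x {v} 2 6 (by simp) (by simpa)
    (by simp; omega) (fun u hu hu' => by
      have := hP u hu (by simpa using hu')
      have := add_le_e (U := {v}) hu
      omega)
  have hvN : ∀ p ∈ B.N x, v ∉ B.N p := fun p hp hh => B.triangle _ _ _ hp hh hvx
  have hyP : ∀ p ∈ B.N x, p ≠ v → y ∉ B.N p := by
    intro p hp hpv
    obtain ⟨s, hs, t, ht, hst, h1, h2, h3⟩ := B.separated v p hpv.symm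
      (fun hh => B.triangle _ _ _ hvx hh hp)
    rcases hNv s hs with rfl | rfl
    · exact absurd (B.symm _ _ hp) h1
    · exact h1
  have c3 := branch_uniform (B := B) (U := {x, v}) y {v} 2 7 (by simp) (by simpa)
    (by simp; omega) (fun u hu hu' => by
      have := hR u hu (by simp at hu'; exact hu'.2)
      have := add_le_e₁ (U := {x, v}) (a := x) hu (by simp) (by grind [B.symm])
      omega)
  simp only [wx, wy] at c2 c3
  obtain ⟨p, hp, hpv⟩ := exists_ne (B := B) hvx (by omega)
  have hp3 := hP3 p hp hpv
  have hxp := B.symm _ _ hp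
  have wp := pair_le_d hvx hp hpv.symm
  have he : ∀ p ∈ B.N x, p ≠ v → ∀ U, v ∈ U → y ∈ U → x ∈ U → ∀ s ∈ B.N p, s ∉ U →
      7 ≤ B.e s p U := by
    intro p hp hpv U hvU hyU hxU s hs hsU
    have hp3 := hP3 p hp hpv
    have hyp := hyP p hp hpv
    have hvp := hvN p hp
    by_cases hys : y ∈ B.N s
    · have h1 := hR s (B.symm _ _ hys) (by rintro rfl; exact hvp hs)
      have := add_le_e₁ (U := U) hs hvU (by grind [B.symm])
      omega
    · have := add_le_e₂ (U := U) (a := v) (b := y) hs ⟨hvU, hyU⟩ (by grind) (by grind [B.symm])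
        (by grind)
      have := two_le_d h s
      omega
  obtain wp1 | wp2 : B.w p = 1 ∨ B.w p = 2 := by have := B.w_pos p; omega
  · obtain ⟨q, hq, hqv, hqp⟩ := exists_third (B := B) hvx hp hpv.symm (by omega)
    have hxq := B.symm _ _ hq
    have wq : B.w q = 1 := by
      have := triple_le_d hvx hp hq ⟨hpv.symm, hqv.symm, hqp.symm⟩
      have := B.w_pos q
      omega
    have hNx := mem_triple_of_d_le hvx hp hq ⟨hpv.symm, hqv.symm, hqp.symm⟩ (by omega)
    have c4 := branch_uniform (B := B) (U := {y, x, v}) p {x} 2 7 (by simp) (by simpa)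
      (by simp; omega) (he p hp hpv _ (by simp) (by simp) (by simp))
    have hqp' : p ∉ B.N q := fun hh => B.triangle _ _ _ hq hh hp
    obtain ⟨s, hs, hsp⟩ := exists_mem_notMem (B := B) hqp hqp'
    have hsx : s ≠ x := by rintro rfl; exact hsp hxp
    have hq3 := hP3 q hq hqv
    have hyq := hyP q hq hqv
    have hvq := hvN q hq
    have c5 := branch_special (B := B) (U := {p, y, x, v}) q {x} s 1 7 (by simp) (by simpa)
      hs (by simpa) (by simp; omega) (he q hq hqv _ (by simp) (by simp) (by simp))
      (fun hsU => by
        by_cases hys : y ∈ B.N s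
        · have h1 := hR s (B.symm _ _ hys) (by rintro rfl; exact hvq hs)
          have := add_le_e₂ (U := {p, y, x, v}) (a := v) (b := p) hs (by simp) (by grind)
            (by grind [B.symm]) (by grind [B.symm])
          omega
        · have := add_le_e₃ (U := {p, y, x, v}) (a := v) (b := y) (c := p) hs (by simp)
            ⟨by grind, hpv.symm, by grind⟩ (by grind [B.symm]) (by grind) (by grind [B.symm])
          have := two_le_d h s
          omega)
    have c6 := B.blocked v x {q, p, y, x, v} hvx (by grind) (by grind)
    rw [wp1] at c4
    rw [wq] at c5
    norm_num at c1 c2 c3 c4 c5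
    linarith
  · have hNx := mem_pair_of_d_le hvx hp hpv.symm (by omega)
    obtain ⟨s, hs, t, ht, hst, hsy, htx, hsN⟩ := B.separated x y hxy
      (fun hh => B.triangle _ _ _ hx hh hy)
    obtain rfl : s = p := by grind
    obtain ⟨a, ha, hax, hay⟩ : ∃ a ∈ B.N s, a ≠ x ∧ y ∉ B.N a := by
      by_contra! hcon
      have hvs := hvN s hp
      have h1 := eq_of_d_le (B := B) (v := y) (T := insert v (B.N s \ {x}))
        (Finset.insert_subset hvy fun a ha => by
          simp only [Finset.mem_sdiff, Finset.mem_singleton] at ha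
          exact B.symm _ _ (hcon a ha.1 ha.2))
        (by
          have := Finset.sum_sdiff (f := B.w) (Finset.singleton_subset_iff.2 hxp)
          rw [Finset.sum_singleton] at this
          rw [Finset.sum_insert (by simp [hvs])]
          unfold d at hp3 dy ⊢
          omega)
      have h2 := h1 t ht
      simp only [Finset.mem_insert, Finset.mem_sdiff] at h2
      rcases h2 with rfl | h2
      · exact htx hvx
      · exact hsN (B.symm _ _ h2.1)
    have hs3 : ∀ u ∈ B.N s, 3 ≤ B.d u := by
      intro u hu
      by_contra hlt
      obtain ⟨-, b, hb, c, hc, hbc, hN, wb, wc, -⟩ := of_d_eq_two (v := u) h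
        (by have := two_le_d h u; omega)
      rcases hN s (B.symm _ _ hu) with rfl | rfl <;> omega
    have hys := hyP s hp hpv
    have hvs := hvN s hp
    have c4 := branch_special (B := B) (U := {y, x, v}) s {x} a 1 7 (by simp) (by simpa)
      ha (by simpa) (by simp; omega) (he s hp hpv _ (by simp) (by simp) (by simp))
      (fun haU => by
        have := add_le_e₂ (U := {y, x, v}) (a := v) (b := y) ha (by simp) (by grind)
            (by grind [B.symm]) (by grind [B.symm])
        have := hs3 a ha
        omega)
    have c6 := B.blocked v x {s, y, x, v} hvx (by grind) (by grind)
    rw [wp2] at c4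
    norm_num at c1 c2 c3 c4
    linarith

theorem of_three_le_w (h : 1 < B.m ∅) (hw : 3 ≤ B.w v) :
    B.w v = 3 ∧ ∀ u ∈ B.N v, B.d u = 4 := by
  have hd := three_le_d h v
  have hu : ∀ u ∈ B.N v, B.w v + 1 ≤ B.d u := fun u hu => w_lt_d h (B.symm _ _ hu)
  obtain ⟨r3, r4, r5, r6, r7, r8, r9, r10, r1, r1', r2, r2'⟩ := rho_facts
  rcases hw.lt_or_eq with hw4 | hw3
  · have h1 := simple_uniform v _ hu
    have h2 := rho_pow_anti (k := 4) hw4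
    have h3 := mul_le_mul (mul_rho_pow_le_one (B.w v)) (mul_rho_pow_le_one (B.d v))
      (mul_nonneg (Nat.cast_nonneg _) (pow_nonneg rho_pos.le _)) zero_le_one
    have h4 := mul_le_mul_of_nonneg_right h3 rho_pos.le
    rw [pow_add, pow_succ] at h1
    linarith
  · rw [← hw3] at hu
    refine ⟨hw3.symm, fun u hu' => ?_⟩
    by_contra hne
    have := hu u hu'
    rcases hd.lt_or_eq with hd4 | hd3
    · have h1 := simple_uniform v 4 hu
      have h2 := mul_rho_pow_anti (k := 4) (by norm_num) hd4
      have h3 := mul_le_mul_of_nonneg_right h2 (pow_pos rho_pos 4).le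
      rw [← hw3, pow_add] at h1
      norm_num at *
      nlinarith
    · have h1 := simple_special v u 2 4 hu' (by omega) hu (by omega)
      rw [← hw3, ← hd3] at h1
      norm_num at *
      linarith

theorem of_w_eq_one (h : 1 < B.m ∅) (hw : B.w v = 1) :
    (B.d v = 3 ∨ B.d v = 4) ∧ ∀ u ∈ B.N v, B.d u = 3 := by
  have hd := three_le_d h v
  have hu : ∀ u ∈ B.N v, 3 ≤ B.d u := fun u hu => three_le_d h u
  obtain ⟨r3, r4, r5, r6, r7, r8, r9, r10, r1, r1', r2, r2'⟩ := rho_facts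
  have hd4 : B.d v ≤ 4 := by
    by_contra! hd5
    have h1 := simple_uniform v 3 hu
    have h2 := mul_rho_pow_anti (k := 5) (by norm_num) hd5
    rw [hw, pow_add] at h1
    norm_num at *
    nlinarith
  have hdd : B.d v = 3 ∨ B.d v = 4 := by omega
  refine ⟨hdd, fun u hu' => ?_⟩
  by_contra hne
  have := hu u hu'
  rcases hdd with hd' | hd'
  · have h1 := simple_special v u 2 3 hu' (by omega) hu (by omega)
    rw [hw, hd'] at h1
    norm_num at *
    linarith
  · have h1 := simple_special v u 3 3 hu' (by omega) hu (by omega)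
    rw [hw, hd'] at h1
    norm_num at *
    linarith

theorem w_le_two (h : 1 < B.m ∅) (v : V) : B.w v ≤ 2 := by
  by_contra! hw
  obtain ⟨hw3, hu⟩ := of_three_le_w h hw
  obtain ⟨x, hx, -⟩ := exists_two h v
  have hvx := B.symm _ _ hx
  have hx4 := hu x hx
  obtain ⟨z, hz, hzv⟩ := exists_ne hvx (by omega)
  have := pair_le_d hvx hz hzv.symm
  have := B.w_pos z
  have := (of_w_eq_one h (v := z) (by omega)).2 x (B.symm _ _ hz)
  omega

/-- The structure of the neighbourhood of a neighbour of weight one of a vertex of weight two. -/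
theorem exists_opposite (h : 1 < B.m ∅) {z x : V} (hz : B.w z = 2) (hx : x ∈ B.N z)
    (wx : B.w x = 1) : ∃ x' ∈ B.N x, x' ≠ z ∧ (∀ u ∈ B.N x, u = z ∨ u = x') ∧
      B.w x' + 2 = B.d x ∧ B.d x' = 3 ∧ z ∉ B.N x' ∧ (B.d x = 3 ∨ B.d x = 4) := by
  obtain ⟨hd, hu⟩ := of_w_eq_one h wx
  have hzx := B.symm _ _ hx
  obtain ⟨x', hx', hne⟩ := exists_ne hzx (by omega)
  have hle := pair_le_d hzx hx' hne.symm
  have hpos := B.w_pos x'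
  have hxx' := B.symm _ _ hx'
  have hw : B.w x' + 2 = B.d x := by
    rcases hd with hd | hd
    · omega
    · have : B.w x' ≠ 1 := fun hh => by
        have := (of_w_eq_one h hh).2 x hxx'
        omega
      omega
  exact ⟨x', hx', hne, mem_pair_of_d_le hzx hx' hne.symm (by omega), hw, hu x' hx',
    fun hh => B.triangle _ _ _ hx' hh hzx, hd⟩

theorem opposite_separated {z x y x' : V} (hx : x ∈ B.N z) (hy : y ∈ B.N z) (hxy : x ≠ y)
    (hN : ∀ u ∈ B.N x, u = z ∨ u = x') :
    x' ∉ B.N y ∧ ∃ t ∈ B.N y, t ≠ z ∧ t ∉ B.N x ∧ x' ≠ t ∧ x' ∉ B.N t := by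
  obtain ⟨s, hs, t, ht, hst, hsy, htx, hsN⟩ := B.separated x y hxy
    (fun hh => B.triangle _ _ _ hx hh hy)
  have hzx := B.symm _ _ hx
  have hzy := B.symm _ _ hy
  obtain rfl : s = x' := by
    rcases hN s hs with rfl | rfl
    · exact absurd hzy hsy
    · rfl
  exact ⟨hsy, t, ht, fun hh => htx (hh ▸ hzx), htx, hst, hsN⟩

theorem no_heavy_of_pair (h : 1 < B.m ∅) {z x y : V} (wz : B.w z = 2) (hx : x ∈ B.N z)
    (hy : y ∈ B.N z) (wx : B.w x = 1) (wy : B.w y = 2) : B.d z ≠ 3 := by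
  intro dz
  have hxy : x ≠ y := by rintro rfl; omega
  have hNz := mem_pair_of_d_le hx hy hxy (by omega)
  obtain ⟨x', hx', hne, hNx, wx', dx', hzx', dx⟩ := exists_opposite h wz hx wx
  obtain ⟨hx'y, t, ht, htz, htx, hx't, hx'N⟩ := opposite_separated hx hy hxy hNx
  have dy := three_le_d h y
  have hzx := B.symm _ _ hx
  have hzy := B.symm _ _ hy
  have hxx' := B.symm _ _ hx'
  have hyx : x ∉ B.N y := fun hh => B.triangle _ _ _ hy hh hx
  have sb := fun k l => simple_pair (B := B) x y k l hxy hx hy hNz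
  obtain ⟨r3, r4, r5, r6, r7, r8, r9, r10, r1, r1', r2, r2'⟩ := rho_facts
  rw [wx, wy, wz, dz] at sb
  have c1 := branch_two (B := B) (v := z) (U := ∅) x y (3 + B.d x) (3 + B.d y) hxy
    (fun u hu _ => hNz u hu) (by have := add_le_e (U := ∅) hx; omega)
    (by have := add_le_e (U := ∅) hy; omega)
  have c2 := branch_one (B := B) (v := x) (U := {z}) x' (3 + B.d x) (by grind)
    (by have := add_le_e (U := {z}) hx'; omega)
  have hxN : ∀ u ∈ B.N y, u ≠ z → x ∉ B.N u := by
    intro u hu huz hxu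
    have := B.symm _ _ hxu
    grind
  have c3 := branch_uniform (B := B) (U := {x, z}) y {z} (B.d y - 2) (B.d y + 4) (by simp)
    (by simpa) (by simp; omega) (fun u hu hu' => by
      have := add_le_e₁ (U := {x, z}) (a := x) hu (by simp) ⟨hxN u hu (by grind), hyx⟩
      have := three_le_d h u
      omega)
  rcases lt_or_ge (B.d y) 4 with dy4 | dy4
  · have dy3 : B.d y = 3 := by omega
    obtain ⟨wt, hNy⟩ : B.w t = 1 ∧ ∀ u ∈ B.N y, u = z ∨ u = t := by
      have := pair_le_d hzy ht htz.symm
      have := B.w_pos t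
      exact ⟨by omega, mem_pair_of_d_le hzy ht htz.symm (by omega)⟩
    obtain ⟨dt, -⟩ := of_w_eq_one h wt
    have hyt := B.symm _ _ ht
    have hzt : z ∉ B.N t := fun hh => B.triangle _ _ _ hy ht (B.symm _ _ hh)
    have hxt := hxN t ht htz
    have c4 := branch_uniform (B := B) (U := {y, x, z}) t {y} (B.d t - 2) (B.d t + 6) (by simp)
      (by simpa) (by simp; omega) (fun u hu hu' => by
        have := add_le_e₂ (U := {y, x, z}) (a := x) (b := z) hu (by simp)
          (by grind [B.irrefl]) ⟨by grind [B.symm], hxt⟩ ⟨by grind [B.symm], hzt⟩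
        have := three_le_d h u
        omega)
    have c5 := B.blocked y z {t, y, x, z} hy (by grind) (by grind)
    rcases dx with dx | dx <;> rcases dt with dt | dt
    all_goals
      obtain wx'' : B.w x' = B.d x - 2 := by omega
      rw [wx'', dx] at c2
      simp only [wx, wy, wz, wt, dy3, dx, dt, insert_empty_eq] at *
      norm_num at *
      linarith
  · have dx3 : B.d x = 3 := by
      by_contra
      have := sb 4 4 (by omega) dy4
      norm_num at this
      linarith
    have dy3 : B.d y = 4 := by
      by_contra
      have := sb 3 5 (by omega) (by omega)
      norm_num at this
      linarith
    have c4 := branch_uniform (B := B) (U := {y, x, z}) x' {x} 2 8 (by simp)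
      (by simpa) (by simp; omega) (fun u hu hu' => by
        have := add_le_e₁ (U := {y, x, z}) (a := z) hu (by simp) ⟨by grind [B.symm], hzx'⟩
        have := three_le_d h u
        omega)
    have c5 := B.blocked x z {x', y, x, z} hx (by grind) (by grind)
    have wx1 : B.w x' = 1 := by omega
    simp only [wx, wy, wz, wx1, dy3, dx3, insert_empty_eq] at *
    norm_num at *
    linarith

theorem no_heavy (h : 1 < B.m ∅) {z : V} (wz : B.w z = 2) : B.d z ≠ 3 := by
  intro dz
  by_cases hall : ∀ u ∈ B.N z, B.w u = 1
  · obtain ⟨x, hx, y, hy, hxy⟩ := exists_two h z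
    have wx := hall x hx
    have wy := hall y hy
    obtain ⟨t, ht, htx, hty⟩ := exists_third hx hy hxy (by omega)
    have wt := hall t ht
    have hNz := mem_triple_of_d_le hx hy ht ⟨hxy, htx.symm, hty.symm⟩ (by omega)
    obtain ⟨x', hx', hnx, hNx, wx', dx', hzx', dx⟩ := exists_opposite h wz hx wx
    obtain ⟨y', hy', hny, hNy, wy', dy', hzy', dy⟩ := exists_opposite h wz hy wy
    obtain ⟨t', ht', hnt, hNt, wt', dt', hzt', dt⟩ := exists_opposite h wz ht wt
    have sxy := opposite_separated hx hy hxy hNx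
    have syx := opposite_separated hy hx hxy.symm hNy
    have sxt := opposite_separated hx ht htx.symm hNx
    have stx := opposite_separated ht hx htx hNt
    have syt := opposite_separated hy ht hty.symm hNy
    have sty := opposite_separated ht hy hty hNt
    have hyx : x ∉ B.N y := fun hh => B.triangle _ _ _ hy hh hx
    have htx' : x ∉ B.N t := fun hh => B.triangle _ _ _ ht hh hx
    have hty' : y ∉ B.N t := fun hh => B.triangle _ _ _ ht hh hy
    have hzx := B.symm _ _ hx
    have hzy := B.symm _ _ hy
    have hzt := B.symm _ _ ht
    have hxx' := B.symm _ _ hx'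
    have c1 := branch_three (B := B) (v := z) (U := ∅) x y t (3 + B.d x) (3 + B.d y) (3 + B.d t)
      ⟨hxy, htx.symm, hty.symm⟩ (fun u hu _ => hNz u hu)
      (by have := add_le_e (U := ∅) hx; omega)
      (by have := add_le_e (U := ∅) hy; omega) (by have := add_le_e (U := ∅) ht; omega)
    have c2 := branch_one (B := B) (v := x) (U := {z}) x' (3 + B.d x) (by grind)
      (by have := add_le_e (U := {z}) hx'; omega)
    have c3 := branch_one (B := B) (v := y) (U := {x, z}) y' (4 + B.d y) (by grind)
      (by
        have := add_le_e₁ (U := {x, z}) (a := x) hy' (by simp) ⟨by grind [B.symm], hyx⟩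
        omega)
    have c4 := branch_one (B := B) (v := t) (U := {y, x, z}) t' (5 + B.d t) (by grind)
      (by
        have := add_le_e₂ (U := {y, x, z}) (a := x) (b := y) ht' (by simp) hxy
          ⟨by grind [B.symm], htx'⟩ ⟨by grind [B.symm], hty'⟩
        omega)
    have c5 := branch_uniform (B := B) (U := {t, y, x, z}) x' {x} 2 10 (by simp)
      (by simpa) (by simp; omega) (fun u hu hu' => by
        have := add_le_e₃ (U := {t, y, x, z}) (a := z) (b := y) (c := t) hu (by simp)
          ⟨by grind [B.irrefl], by grind [B.irrefl], hty.symm⟩ ⟨by grind [B.symm], hzx'⟩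
          ⟨by grind [B.symm], by grind [B.symm]⟩ ⟨by grind [B.symm], by grind [B.symm]⟩
        have := three_le_d h u
        omega)
    have c6 := B.blocked x z {x', t, y, x, z} hx (by grind) (by grind)
    obtain ⟨r3, r4, r5, r6, r7, r8, r9, r10, r1, r1', r2, r2'⟩ := rho_facts
    clear sxy syx sxt stx syt sty hNx hNy hNt hNz hall
    rcases dx with dx | dx <;> rcases dy with dy | dy <;> rcases dt with dt | dt
    all_goals
      have wx'' : B.w x' = B.d x - 2 := by omega
      have wy'' : B.w y' = B.d y - 2 := by omega
      have wt'' : B.w t' = B.d t - 2 := by omega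
      simp only [wx, wy, wz, wt, wx'', wy'', wt'', dy, dx, dt, insert_empty_eq] at c1 c2 c3 c4 c5
      norm_num at *
      linarith
  · push Not at hall
    obtain ⟨y, hy, hyw⟩ := hall
    have := w_le_two h y
    have := B.w_pos y
    obtain ⟨x, hx, hxy⟩ := exists_ne hy (by omega)
    have := pair_le_d hy hx hxy.symm
    have := B.w_pos x
    exact no_heavy_of_pair h wz hx hy (by omega) (by omega) dz

/-- Vertices of weight one have degree three and neighbours of weight one. -/
theorem cubic_of_w_eq_one (h : 1 < B.m ∅) (hw : B.w v = 1) :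
    B.d v = 3 ∧ ∀ u ∈ B.N v, B.w u = 1 := by
  obtain ⟨hd, hu⟩ := of_w_eq_one h hw
  have hu1 : ∀ u ∈ B.N v, B.w u = 1 := by
    intro u huv
    by_contra hne
    have := w_le_two h u
    have := B.w_pos u
    exact no_heavy h (z := u) (by omega) (hu u huv)
  refine ⟨?_, hu1⟩
  obtain ⟨x, hx, -⟩ := exists_two h v
  exact (of_w_eq_one h (hu1 x hx)).2 v (B.symm _ _ hx)

theorem exists_w_eq_one (h : 1 < B.m ∅) (v : V) : ∃ u, B.w u = 1 := by
  by_contra! hne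
  have hw2 : ∀ u, B.w u = 2 := by
    intro u
    have := w_le_two h u
    have := B.w_pos u
    have := hne u
    omega
  have hd4 : ∀ u, 4 ≤ B.d u := by
    intro u
    have := three_le_d h u
    have := no_heavy h (hw2 u)
    omega
  have h1 := simple_uniform v 4 (fun u _ => hd4 u)
  have h2 := mul_rho_pow_anti (k := 4) (by norm_num) (hd4 v)
  have h3 := mul_le_mul_of_nonneg_right h2 (pow_pos rho_pos 4).le
  obtain ⟨r3, r4, r5, r6, r7, r8, r9, r10, r1, r1', r2, r2'⟩ := rho_facts
  rw [hw2, pow_add] at h1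
  norm_num at *
  nlinarith

/-- A vertex of weight one with two given neighbours has exactly one more neighbour. -/
theorem exists_neighbors (h : 1 < B.m ∅) (hw : B.w v = 1) (ha : a ∈ B.N v) (hb : b ∈ B.N v)
    (hab : a ≠ b) :
    ∃ c ∈ B.N v, a ≠ c ∧ b ≠ c ∧ B.w c = 1 ∧ ∀ u ∈ B.N v, u = a ∨ u = b ∨ u = c := by
  obtain ⟨hd, hu⟩ := cubic_of_w_eq_one h hw
  have wa := hu a ha
  have wb := hu b hb
  obtain ⟨c, hc, hca, hcb⟩ := exists_third ha hb hab (by omega)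
  have wc := hu c hc
  exact ⟨c, hc, hca.symm, hcb.symm, wc,
    mem_triple_of_d_le ha hb hc ⟨hab, hca.symm, hcb.symm⟩ (by omega)⟩

theorem no_square (h : 1 < B.m ∅) {v p x y : V} (wv : B.w v = 1) (hvp : v ≠ p) (hxy : x ≠ y)
    (hx : x ∈ B.N v) (hxp : x ∈ B.N p) (hy : y ∈ B.N v) (hyp : y ∈ B.N p) : False := by
  obtain ⟨dv, wNv⟩ := cubic_of_w_eq_one h wv
  have wx := wNv x hx
  have wy := wNv y hy
  obtain ⟨dx, wNx⟩ := cubic_of_w_eq_one h wx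
  obtain ⟨dy, wNy⟩ := cubic_of_w_eq_one h wy
  have hvx := B.symm _ _ hx
  have hvy := B.symm _ _ hy
  have hpx := B.symm _ _ hxp
  have hpy := B.symm _ _ hyp
  have wp := wNx p hpx
  obtain ⟨dp, wNp⟩ := cubic_of_w_eq_one h wp
  obtain ⟨z, hz, hxz, hyz, wz, hNv⟩ := exists_neighbors h wv hx hy hxy
  obtain ⟨p', hp', hxp', hyp', wp', hNp⟩ := exists_neighbors h wp hxp hyp hxy
  obtain ⟨q, hq, hvq, hpq, wq, hNx⟩ := exists_neighbors h wx hvx hpx hvp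
  obtain ⟨r, hr, hvr, hpr, wr, hNy⟩ := exists_neighbors h wy hvy hpy hvp
  obtain ⟨dz, wNz⟩ := cubic_of_w_eq_one h wz
  obtain ⟨dp', -⟩ := cubic_of_w_eq_one h wp'
  obtain ⟨dq, wNq⟩ := cubic_of_w_eq_one h wq
  obtain ⟨dr, -⟩ := cubic_of_w_eq_one h wr
  have hvz := B.symm _ _ hz
  have hxq := B.symm _ _ hq
  have hyr := B.symm _ _ hr
  have hpv : p ∉ B.N v := B.triangle _ _ _ hx hpx
  have hyx : y ∉ B.N x := fun hh => B.triangle _ _ _ hx hh hy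
  obtain ⟨hzp', hzp'n⟩ : z ≠ p' ∧ z ∉ B.N p' := by
    obtain ⟨s, hs, t, ht, hst, hs', ht', hst'⟩ := B.separated v p hvp hpv
    rcases hNv s hs with rfl | rfl | rfl
    · exact absurd hxp hs'
    · exact absurd hyp hs'
    rcases hNp t ht with rfl | rfl | rfl
    · exact absurd hx ht'
    · exact absurd hy ht'
    exact ⟨hst, hst'⟩
  obtain ⟨hqr, hqrn⟩ : q ≠ r ∧ q ∉ B.N r := by
    obtain ⟨s, hs, t, ht, hst, hs', ht', hst'⟩ := B.separated x y hxy hyx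
    rcases hNx s hs with rfl | rfl | rfl
    · exact absurd hvy hs'
    · exact absurd hpy hs'
    rcases hNy t ht with rfl | rfl | rfl
    · exact absurd hvx ht'
    · exact absurd hpx ht'
    exact ⟨hst, hst'⟩
  have hqv : v ∉ B.N q := fun hh => B.triangle _ _ _ hvx (B.symm _ _ hh) hq
  have hqp : p ∉ B.N q := fun hh => B.triangle _ _ _ hpx (B.symm _ _ hh) hq
  have hqy : y ∉ B.N q := by grind [B.symm]
  have hzx : x ∉ B.N z := fun hh => B.triangle _ _ _ hz hh hx
  have hzy : y ∉ B.N z := fun hh => B.triangle _ _ _ hz hh hy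
  have hzp : p ∉ B.N z := by grind [B.symm]
  have c1 := branch_uniform (B := B) (U := ∅) v ∅ 3 6 (by simp) (by simp) (by simpa using dv.symm)
    (fun u hu _ => by
      have := three_le_d h u
      have := add_le_e (U := ∅) hu
      omega)
  have c2 := branch_special (B := B) (U := {v}) p ∅ p' 2 6 (by simp) (by simp) hp' (by simp)
    (by simp; omega)
    (fun u hu _ => by
      have := three_le_d h u
      have := add_le_e (U := {v}) hu
      omega)
    (fun _ => by
      have := add_le_e₁ (U := {v}) (a := v) hp' (by simp) ⟨by grind [B.symm], by grind [B.symm]⟩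
      omega)
  have c3 := branch_one (B := B) (v := x) (U := {p, v}) q 6 (by grind)
    (by have := add_le_e (U := {p, v}) hq; omega)
  have c4 := branch_one (B := B) (v := y) (U := {x, p, v}) r 7 (by grind)
    (by
      have := add_le_e₁ (U := {x, p, v}) (a := x) hr (by simp)
        ⟨by grind [B.symm], by grind [B.symm]⟩
      omega)
  have c7 := B.blocked x v {z, q, y, x, p, v} hx (by grind) (by grind)
  obtain ⟨r3, r4, r5, r6, r7, r8, r9, r10, r1, r1', r2, r2'⟩ := rho_facts
  have e8 : ∀ u ∈ B.N q, u ∉ ({y, x, p, v} : Finset V) → 8 ≤ B.e u q {y, x, p, v} := by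
    intro u hu hu'
    have := three_le_d h u
    have hyu : y ∉ B.N u := by grind [B.symm]
    by_cases huv : v ∈ B.N u
    · have := add_le_e₂ (U := {y, x, p, v}) (a := y) (b := p) hu (by simp) (by grind [B.irrefl])
        ⟨hyu, hqy⟩ ⟨by grind [B.symm], hqp⟩
      omega
    · have := add_le_e₂ (U := {y, x, p, v}) (a := y) (b := v) hu (by simp) (by grind [B.irrefl])
        ⟨hyu, hqy⟩ ⟨huv, hqv⟩
      omega
  by_cases hzq : q ∈ B.N z
  · have c5 := branch_uniform (B := B) (U := {y, x, p, v}) q {x} 2 8 (by simp) (by simpa)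
      (by simp; omega) e8
    obtain ⟨t, ht, hvt, hqt, wt, hNz⟩ := exists_neighbors h wz hvz hzq hvq
    obtain ⟨dt, -⟩ := cubic_of_w_eq_one h wt
    have c6 := branch_one (B := B) (v := z) (U := {q, y, x, p, v}) t 8 (by grind)
      (by
        have := add_le_e₂ (U := {q, y, x, p, v}) (a := x) (b := p) ht (by simp)
          (by grind [B.irrefl]) ⟨by grind [B.symm], hzx⟩ ⟨by grind [B.symm], hzp⟩
        omega)
    simp only [wv, wp, wx, wy, wz, wq, wr, wt, insert_empty_eq] at c1 c2 c3 c4 c5 c6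
    norm_num at c1 c2 c3 c4 c5 c6
    linarith
  · obtain ⟨q₁, hq₁, hq₁x, hq₁p⟩ : ∃ u ∈ B.N q, x ≠ u ∧ u ≠ p' := by
      obtain ⟨b, hb, hbx⟩ := exists_ne hxq (by omega)
      obtain ⟨c, hc, hxc, hbc, -⟩ := exists_neighbors h wq hxq hb hbx.symm
      by_cases hbp : b = p'
      · exact ⟨c, hc, hxc, by grind⟩
      · exact ⟨b, hb, hbx.symm, hbp⟩
    have c5 := branch_special (B := B) (U := {y, x, p, v}) q {x} q₁ 1 8 (by simp) (by simpa)
      hq₁ (by simpa using hq₁x.symm) (by simp; omega) e8 (fun hu' => by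
        have := three_le_d h q₁
        have := add_le_e₃ (U := {y, x, p, v}) (a := y) (b := p) (c := v) hq₁ (by simp)
          ⟨by grind [B.irrefl], by grind [B.irrefl], hvp.symm⟩ ⟨by grind [B.symm], hqy⟩
          ⟨by grind [B.symm], hqp⟩ ⟨by grind [B.symm], hqv⟩
        omega)
    have c6 := branch_uniform (B := B) (U := {q, y, x, p, v}) z {v} 2 9 (by simp) (by simpa)
      (by simp; omega) (fun u hu hu' => by
        have := three_le_d h u
        have hxu : x ∉ B.N u := by grind [B.symm]
        have hpu : p ∉ B.N u := by grind [B.symm]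
        by_cases hqu : q ∈ B.N u
        · have := add_le_e₃ (U := {q, y, x, p, v}) (a := x) (b := p) (c := y) hu (by simp)
            ⟨by grind [B.irrefl], hxy, by grind [B.irrefl]⟩ ⟨hxu, hzx⟩
            ⟨hpu, hzp⟩ ⟨by grind [B.symm], hzy⟩
          omega
        · have := add_le_e₃ (U := {q, y, x, p, v}) (a := x) (b := p) (c := q) hu (by simp)
            ⟨by grind [B.irrefl], by grind [B.irrefl], hpq⟩ ⟨hxu, hzx⟩
            ⟨hpu, hzp⟩ ⟨hqu, hzq⟩
          omega)
    simp only [wv, wp, wx, wy, wz, wq, wr, insert_empty_eq] at c1 c2 c3 c4 c5 c6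
    norm_num at c1 c2 c3 c4 c5 c6
    linarith

theorem m_empty_le_one (v₀ : V) : B.m ∅ ≤ 1 := by
  by_contra! h
  obtain ⟨v, wv⟩ := exists_w_eq_one h v₀
  obtain ⟨dv, wNv⟩ := cubic_of_w_eq_one h wv
  obtain ⟨x, hx, y, hy, hxy⟩ := exists_two h v
  obtain ⟨z, hz, hxz, hyz, wz, hNv⟩ := exists_neighbors h wv hx hy hxy
  have wx := wNv x hx
  have wy := wNv y hy
  obtain ⟨dx, wNx⟩ := cubic_of_w_eq_one h wx
  obtain ⟨dy, wNy⟩ := cubic_of_w_eq_one h wy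
  obtain ⟨dz, wNz⟩ := cubic_of_w_eq_one h wz
  have hvx := B.symm _ _ hx
  have hvy := B.symm _ _ hy
  have hvz := B.symm _ _ hz
  obtain ⟨x₁, hx₁, hvx₁⟩ := exists_ne hvx (by omega)
  obtain ⟨x₂, hx₂, hvx₂, hx₁₂, wx₂, hNx⟩ := exists_neighbors h wx hvx hx₁ hvx₁.symm
  have wx₁ := wNx x₁ hx₁
  obtain ⟨dx₁, -⟩ := cubic_of_w_eq_one h wx₁
  obtain ⟨dx₂, -⟩ := cubic_of_w_eq_one h wx₂
  have hxx₁ := B.symm _ _ hx₁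
  have hxx₂ := B.symm _ _ hx₂
  have hsq : ∀ b s t, v ≠ b → s ≠ t → s ∈ B.N v → s ∈ B.N b → t ∈ B.N v → t ∈ B.N b → False :=
    fun b s t h1 h2 h3 h4 h5 h6 => no_square h wv h1 h2 h3 h4 h5 h6
  have hsqx : ∀ b s t, x ≠ b → s ≠ t → s ∈ B.N x → s ∈ B.N b → t ∈ B.N x → t ∈ B.N b → False :=
    fun b s t h1 h2 h3 h4 h5 h6 => no_square h wx h1 h2 h3 h4 h5 h6
  have hyx : x ∉ B.N y := fun hh => B.triangle _ _ _ hy hh hx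
  have hzx : x ∉ B.N z := fun hh => B.triangle _ _ _ hz hh hx
  have hzy : y ∉ B.N z := fun hh => B.triangle _ _ _ hz hh hy
  have hvu : ∀ u, u ≠ x → u ≠ y → u ≠ z → v ∉ B.N u := by grind [B.symm]
  have c1 := branch_uniform (B := B) (U := ∅) v ∅ 3 6 (by simp) (by simp) (by simpa using dv.symm)
    (fun u hu _ => by
      have := three_le_d h u
      have := add_le_e (U := ∅) hu
      omega)
  have c2 := branch_uniform (B := B) (U := {v}) x {v} 2 6 (by simp) (by simpa) (by simp; omega)
    (fun u hu _ => by
      have := three_le_d h u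
      have := add_le_e (U := {v}) hu
      omega)
  have c3 := branch_uniform (B := B) (U := {x, v}) y {v} 2 7 (by simp) (by simpa)
    (by simp; omega) (fun u hu hu' => by
      have := three_le_d h u
      have := add_le_e₁ (U := {x, v}) (a := x) hu (by simp)
        ⟨fun hh => hsq u x y (by grind) hxy hx hh hy (B.symm _ _ hu), hyx⟩
      omega)
  have c4 := branch_uniform (B := B) (U := {y, x, v}) z {v} 2 8 (by simp) (by simpa)
    (by simp; omega) (fun u hu hu' => by
      have := three_le_d h u
      have := add_le_e₂ (U := {y, x, v}) (a := x) (b := y) hu (by simp) hxy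
        ⟨fun hh => hsq u x z (by grind) hxz hx hh hz (B.symm _ _ hu), hzx⟩
        ⟨fun hh => hsq u y z (by grind) hyz hy hh hz (B.symm _ _ hu), hzy⟩
      omega)
  have hne : ∀ u ∈ B.N v, u ≠ v := fun u hu hh => B.irrefl v (hh ▸ hu)
  have hyv := hne y hy
  have hzv := hne z hz
  have key : ∀ i ∈ B.N x, i ≠ v → v ∉ B.N i ∧ y ∉ B.N i ∧ z ∉ B.N i := by
    intro i hi hiv
    exact ⟨fun hh => B.triangle _ _ _ hx hi (B.symm _ _ hh),
      fun hh => hsq i x y hiv.symm hxy hx (B.symm _ _ hi) hy hh,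
      fun hh => hsq i x z hiv.symm hxz hx (B.symm _ _ hi) hz hh⟩
  obtain ⟨k1v, k1y, k1z⟩ := key x₁ hx₁ hvx₁
  obtain ⟨k2v, k2y, k2z⟩ := key x₂ hx₂ hvx₂.symm
  have c5 := branch_uniform (B := B) (U := {z, y, x, v}) x₁ {x} 2 8 (by simp) (by simpa)
    (by simp; omega) (fun u hu hu' => by
      have := three_le_d h u
      have hv := hvu u (by grind) (by grind) (by grind)
      by_cases hyu : y ∈ B.N u
      · have := add_le_e₂ (U := {z, y, x, v}) (a := v) (b := z) hu (by simp) hzv.symm ⟨hv, k1v⟩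
          ⟨fun hh => hsq u y z (by grind) hyz hy hyu hz hh, k1z⟩
        omega
      · have := add_le_e₂ (U := {z, y, x, v}) (a := v) (b := y) hu (by simp) hyv.symm ⟨hv, k1v⟩
          ⟨hyu, k1y⟩
        omega)
  have c6 := branch_uniform (B := B) (U := {x₁, z, y, x, v}) x₂ {x} 2 9 (by simp) (by simpa)
    (by simp; omega) (fun u hu hu' => by
      have := three_le_d h u
      have hv := hvu u (by grind) (by grind) (by grind)
      have h1 : x₁ ∉ B.N u := fun hh =>
        hsqx u x₁ x₂ (by grind) hx₁₂ hx₁ hh hx₂ (B.symm _ _ hu)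
      have h2 : x₁ ∉ B.N x₂ := fun hh => B.triangle _ _ _ hx₂ hh hx₁
      by_cases hyu : y ∈ B.N u
      · have := add_le_e₃ (U := {x₁, z, y, x, v}) (a := v) (b := x₁) (c := z) hu (by simp)
          ⟨hvx₁.symm, hzv.symm, by grind⟩ ⟨hv, k2v⟩ ⟨h1, h2⟩
          ⟨fun hh => hsq u y z (by grind) hyz hy hyu hz hh, k2z⟩
        omega
      · have := add_le_e₃ (U := {x₁, z, y, x, v}) (a := v) (b := x₁) (c := y) hu (by simp)
          ⟨hvx₁.symm, hyv.symm, by grind⟩ ⟨hv, k2v⟩ ⟨h1, h2⟩ ⟨hyu, k2y⟩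
        omega)
  have c7 := B.blocked x v {x₂, x₁, z, y, x, v} hx (by grind) (by grind)
  obtain ⟨r3, r4, r5, r6, r7, r8, r9, r10, r1, r1', r2, r2'⟩ := rho_facts
  simp only [wv, wx, wy, wz, wx₁, wx₂, insert_empty_eq] at c1 c2 c3 c4 c5 c6
  norm_num at c1 c2 c3 c4 c5 c6
  linarith

end BranchSystem

section Graph

open scoped Classical in
/-- The vertex sets covered by the maximal induced matchings of the subgraph induced by `S`. -/
noncomputable def coverFamily {V : Type*} [DecidableEq V] (G : SimpleGraph V) (S : Finset V) :
    Finset (Finset V) :=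
  {C ∈ S.powerset | (∀ v ∈ C, ∃! u, u ∈ C ∧ G.Adj v u) ∧
    ∀ u ∈ S, ∀ v ∈ S, G.Adj u v → ∃ c ∈ C, G.Adj c u ∨ G.Adj c v}

/-- The weighted number of maximal induced matchings of the subgraph induced by `S` that cover
no vertex of `U`. -/
noncomputable def weightedCount {V : Type*} [DecidableEq V] (G : SimpleGraph V) (w : V → ℕ)
    (S U : Finset V) : ℝ :=
  ∑ C ∈ coverFamily G S with Disjoint C U, ∏ v ∈ C, (w v : ℝ)

theorem prod_natCast_nonneg {V : Type*} (w : V → ℕ) (C : Finset V) :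
    (0 : ℝ) ≤ ∏ v ∈ C, (w v : ℝ) :=
  Finset.prod_nonneg fun _ _ => Nat.cast_nonneg _

variable {V : Type*} [DecidableEq V] {G : SimpleGraph V} {w : V → ℕ} {S U X C : Finset V}
  {u v : V}

theorem mem_coverFamily : C ∈ coverFamily G S ↔ C ⊆ S ∧
    (∀ v ∈ C, ∃! u, u ∈ C ∧ G.Adj v u) ∧
    ∀ u ∈ S, ∀ v ∈ S, G.Adj u v → ∃ c ∈ C, G.Adj c u ∨ G.Adj c v := by
  simp [coverFamily]

theorem eq_of_mem_coverFamily {x y z : V} (hC : C ∈ coverFamily G S) (hx : x ∈ C) (hy : y ∈ C)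
    (hz : z ∈ C) (hxy : G.Adj x y) (hxz : G.Adj x z) : y = z :=
  ((mem_coverFamily.1 hC).2.1 x hx).unique ⟨hy, hxy⟩ ⟨hz, hxz⟩

theorem weightedCount_empty_right :
    weightedCount G w S ∅ = ∑ C ∈ coverFamily G S, ∏ v ∈ C, (w v : ℝ) := by
  simp [weightedCount]

theorem weightedCount_le_sdiff :
    weightedCount G w S U ≤ weightedCount G w (S \ U) ∅ := by
  rw [weightedCount_empty_right]
  refine Finset.sum_le_sum_of_subset_of_nonneg (fun C hC => ?_)
    fun C _ _ => prod_natCast_nonneg w C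
  rw [Finset.mem_filter, mem_coverFamily] at hC
  obtain ⟨⟨hCS, h1, h2⟩, hd⟩ := hC
  refine mem_coverFamily.2 ⟨fun x hx => ?_, h1, fun a ha b hb => ?_⟩
  · exact Finset.mem_sdiff.2 ⟨hCS hx, Finset.disjoint_left.1 hd hx⟩
  · exact h2 a (Finset.mem_sdiff.1 ha).1 b (Finset.mem_sdiff.1 hb).1

theorem weightedCount_eq_zero (huv : G.Adj u v) (hu : u ∈ S) (hv : v ∈ S)
    (hUu : ∀ x ∈ S, G.Adj x u → x ∈ U) (hUv : ∀ x ∈ S, G.Adj x v → x ∈ U) :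
    weightedCount G w S U = 0 := by
  rw [weightedCount, Finset.filter_eq_empty_iff.2, Finset.sum_empty]
  intro C hC hd
  obtain ⟨hCS, -, h⟩ := mem_coverFamily.1 hC
  obtain ⟨c, hc, hcu | hcv⟩ := h u hu v hv huv
  · exact Finset.disjoint_left.1 hd hc (hUu c (hCS hc) hcu)
  · exact Finset.disjoint_left.1 hd hc (hUv c (hCS hc) hcv)

/-- Removing the edge `u v` and everything it conflicts with. -/
theorem sum_coverFamily_edge_le (huv : G.Adj u v) (hX : ∀ x, x ∈ X → G.Adj u x ∨ G.Adj v x ∨ x ∈ U)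
    (hu : ∀ x ∈ S, G.Adj u x → x ∈ X) (hv : ∀ x ∈ S, G.Adj v x → x ∈ X) :
    ∑ C ∈ coverFamily G S with Disjoint C U ∧ v ∈ C ∧ u ∈ C, ∏ i ∈ C, (w i : ℝ) ≤
      w v * w u * weightedCount G w (S \ X) ∅ := by
  rw [weightedCount_empty_right, Finset.mul_sum]
  have hP : ∀ C : Finset V, v ∈ C → u ∈ C →
      ∏ i ∈ C, (w i : ℝ) = w v * w u * ∏ i ∈ (C.erase v).erase u, (w i : ℝ) := by
    intro C hv hu
    rw [mul_assoc, Finset.mul_prod_erase _ (fun i => (w i : ℝ)) (Finset.mem_erase.2 ⟨huv.ne, hu⟩),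
      Finset.mul_prod_erase _ (fun i => (w i : ℝ)) hv]
  rw [Finset.sum_congr rfl fun C hC => hP C (Finset.mem_filter.1 hC).2.2.1
    (Finset.mem_filter.1 hC).2.2.2]
  rw [← Finset.sum_image (g := fun C : Finset V => (C.erase v).erase u)
    (f := fun C => (w v * w u * ∏ i ∈ C, (w i : ℝ)))]
  · refine Finset.sum_le_sum_of_subset_of_nonneg (fun C' hC' => ?_) fun C _ _ =>
      mul_nonneg (by positivity) (prod_natCast_nonneg w C)
    obtain ⟨C, hC, rfl⟩ := Finset.mem_image.1 hC'
    rw [Finset.mem_filter] at hC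
    obtain ⟨hC, hd, hvC, huC⟩ := hC
    obtain ⟨hCS, h1, h2⟩ := mem_coverFamily.1 hC
    refine mem_coverFamily.2 ⟨fun x hx => ?_, fun x hx => ?_, fun a ha b hb hab => ?_⟩
    · simp only [Finset.mem_erase] at hx
      refine Finset.mem_sdiff.2 ⟨hCS hx.2.2, fun hxX => ?_⟩
      rcases hX x hxX with h | h | h
      · exact hx.2.1 (eq_of_mem_coverFamily hC huC hx.2.2 hvC h huv)
      · exact hx.1 (eq_of_mem_coverFamily hC hvC hx.2.2 huC h huv.symm)
      · exact Finset.disjoint_left.1 hd hx.2.2 h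
    · simp only [Finset.mem_erase] at hx
      obtain ⟨y, ⟨hy, hxy⟩, -⟩ := h1 x hx.2.2
      refine ⟨y, ⟨?_, hxy⟩, fun z hz => ?_⟩
      · simp only [Finset.mem_erase]
        refine ⟨?_, ?_, hy⟩
        · rintro rfl
          exact hx.2.1 (eq_of_mem_coverFamily hC huC hx.2.2 hvC hxy.symm huv)
        · rintro rfl
          exact hx.1 (eq_of_mem_coverFamily hC hvC hx.2.2 huC hxy.symm huv.symm)
      · simp only [Finset.mem_erase] at hz
        exact eq_of_mem_coverFamily hC hx.2.2 hz.1.2.2 hy hz.2 hxy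
    · rw [Finset.mem_sdiff] at ha hb
      obtain ⟨c, hc, hcab⟩ := h2 a ha.1 b hb.1 hab
      refine ⟨c, ?_, hcab⟩
      simp only [Finset.mem_erase]
      refine ⟨?_, ?_, hc⟩
      · rintro rfl
        exact hcab.elim (fun h => ha.2 (hu a ha.1 h)) (fun h => hb.2 (hu b hb.1 h))
      · rintro rfl
        exact hcab.elim (fun h => ha.2 (hv a ha.1 h)) (fun h => hb.2 (hv b hb.1 h))
  · intro C hC D hD h
    simp only [Finset.coe_filter, Set.mem_ofPred_eq] at hC hD
    have h' := congrArg (fun C => insert v (insert u C)) h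
    simp only at h'
    rwa [Finset.insert_erase (Finset.mem_erase.2 ⟨huv.ne, hC.2.2.2⟩),
      Finset.insert_erase (Finset.mem_erase.2 ⟨huv.ne, hD.2.2.2⟩),
      Finset.insert_erase hC.2.2.1, Finset.insert_erase hD.2.2.1] at h'

theorem weightedCount_branch (A : Finset V)
    (hA : ∀ u ∈ S, G.Adj v u → u ∉ U → u ∈ A) (hAv : ∀ u ∈ A, G.Adj v u) (X : V → Finset V)
    (hX : ∀ u ∈ A, ∀ x, x ∈ X u ↔ x ∈ S ∧ (G.Adj u x ∨ G.Adj v x ∨ x ∈ U)) :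
    weightedCount G w S U ≤ weightedCount G w S (insert v U) +
      ∑ u ∈ A, w v * w u * weightedCount G w (S \ X u) ∅ := by
  have hsub : {C ∈ coverFamily G S | Disjoint C U} ⊆
      {C ∈ coverFamily G S | Disjoint C (insert v U)} ∪
        A.biUnion fun u => {C ∈ coverFamily G S | Disjoint C U ∧ v ∈ C ∧ u ∈ C} := by
    intro C hC
    rw [Finset.mem_filter] at hC
    rw [Finset.mem_union]
    by_cases hv : v ∈ C
    · right
      obtain ⟨u, ⟨hu, hvu⟩, -⟩ := (mem_coverFamily.1 hC.1).2.1 v hv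
      exact Finset.mem_biUnion.2 ⟨u, hA u ((mem_coverFamily.1 hC.1).1 hu) hvu
        (Finset.disjoint_left.1 hC.2 hu), Finset.mem_filter.2 ⟨hC.1, hC.2, hv, hu⟩⟩
    · left
      rw [Finset.mem_filter, Finset.disjoint_insert_right]
      exact ⟨hC.1, hv, hC.2⟩
  have hle : ∀ (s t : Finset (Finset V)), ∑ C ∈ s ∪ t, ∏ i ∈ C, (w i : ℝ) ≤
      ∑ C ∈ s, ∏ i ∈ C, (w i : ℝ) + ∑ C ∈ t, ∏ i ∈ C, (w i : ℝ) := by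
    intro s t
    rw [← Finset.sum_union_inter]
    exact le_add_of_nonneg_right (Finset.sum_nonneg fun C _ => prod_natCast_nonneg w C)
  have hbi : ∀ (B : Finset V) (f : V → Finset (Finset V)),
      ∑ C ∈ B.biUnion f, ∏ i ∈ C, (w i : ℝ) ≤ ∑ u ∈ B, ∑ C ∈ f u, ∏ i ∈ C, (w i : ℝ) := by
    intro B f
    induction B using Finset.induction_on with
    | empty => simp
    | insert b B hb ih =>
      rw [Finset.biUnion_insert, Finset.sum_insert hb]
      exact (hle _ _).trans (by gcongr)
  refine (Finset.sum_le_sum_of_subset_of_nonneg hsub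
    fun C _ _ => prod_natCast_nonneg w C).trans ((hle _ _).trans (add_le_add ?_ ((hbi _ _).trans
      (Finset.sum_le_sum fun u hu => ?_))))
  · exact le_rfl
  · exact sum_coverFamily_edge_le (hAv u hu).symm (fun x hx => ((hX u hu x).1 hx).2)
      (fun x hx h => (hX u hu x).2 ⟨hx, Or.inl h⟩)
      (fun x hx h => (hX u hu x).2 ⟨hx, Or.inr (Or.inl h)⟩)

/-- Moving the weight of `v` to `u` when no maximal induced matching covers both. -/
theorem weightedCount_le_update (huv : u ≠ v)
    (h : ∀ C ∈ coverFamily G S, u ∈ C → v ∉ C)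
    (hle : ∑ C ∈ coverFamily G S with v ∈ C, ∏ i ∈ C.erase v, (w i : ℝ) ≤
      ∑ C ∈ coverFamily G S with u ∈ C, ∏ i ∈ C.erase u, (w i : ℝ)) :
    weightedCount G w S ∅ ≤ weightedCount G (Function.update w u (w u + w v)) (S.erase v) ∅ := by
  set w' := Function.update w u (w u + w v) with hw'
  have h1 : weightedCount G w' S {v} ≤ weightedCount G w' (S.erase v) ∅ := by
    rw [← Finset.sdiff_singleton_eq_erase]
    exact weightedCount_le_sdiff
  refine le_trans ?_ h1
  have hw'u : ∀ C : Finset V, u ∉ C → ∏ i ∈ C, (w' i : ℝ) = ∏ i ∈ C, (w i : ℝ) := by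
    intro C hC
    refine Finset.prod_congr rfl fun i hi => ?_
    rw [hw', Function.update_of_ne (by rintro rfl; exact hC hi)]
  have e1 : weightedCount G w' S {v} =
      (∑ C ∈ coverFamily G S with u ∈ C, ∏ i ∈ C, (w' i : ℝ)) +
      ∑ C ∈ coverFamily G S with u ∉ C ∧ v ∉ C, ∏ i ∈ C, (w i : ℝ) := by
    simp only [weightedCount, Finset.disjoint_singleton_right]
    rw [← Finset.sum_filter_add_sum_filter_not _ (fun C => u ∈ C), Finset.filter_filter,
      Finset.filter_filter]
    congr 1
    · exact Finset.sum_congr (Finset.filter_congr fun C hC =>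
        ⟨And.right, fun hu => ⟨h C hC hu, hu⟩⟩) fun _ _ => rfl
    · exact Finset.sum_congr (Finset.filter_congr fun C hC => And.comm)
        fun C hC => hw'u C (Finset.mem_filter.1 hC).2.1
  have e2 : weightedCount G w S ∅ =
      (∑ C ∈ coverFamily G S with u ∈ C, ∏ i ∈ C, (w i : ℝ)) +
      ((∑ C ∈ coverFamily G S with v ∈ C, ∏ i ∈ C, (w i : ℝ)) +
      ∑ C ∈ coverFamily G S with u ∉ C ∧ v ∉ C, ∏ i ∈ C, (w i : ℝ)) := by
    rw [weightedCount_empty_right, ← Finset.sum_filter_add_sum_filter_not _ (fun C => u ∈ C)]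
    congr 1
    rw [← Finset.sum_filter_add_sum_filter_not _ (fun C => v ∈ C), Finset.filter_filter,
      Finset.filter_filter]
    congr 1
    exact Finset.sum_congr (Finset.filter_congr fun C hC =>
      ⟨And.right, fun hv => ⟨fun hu => h C hC hu hv, hv⟩⟩) fun _ _ => rfl
  have e3 : ∀ (x : V) (f : V → ℕ), (∑ C ∈ coverFamily G S with x ∈ C, ∏ i ∈ C, (f i : ℝ)) =
      f x * ∑ C ∈ coverFamily G S with x ∈ C, ∏ i ∈ C.erase x, (f i : ℝ) := by
    intro x f
    rw [Finset.mul_sum]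
    exact Finset.sum_congr rfl fun C hC =>
      (Finset.mul_prod_erase _ (fun i => (f i : ℝ)) (Finset.mem_filter.1 hC).2).symm
  have e4 : (∑ C ∈ coverFamily G S with u ∈ C, ∏ i ∈ C.erase u, (w' i : ℝ)) =
      ∑ C ∈ coverFamily G S with u ∈ C, ∏ i ∈ C.erase u, (w i : ℝ) :=
    Finset.sum_congr rfl fun C _ => hw'u _ (Finset.notMem_erase u C)
  have e5 : (w' u : ℝ) = w u + w v := by simp [hw']
  rw [e1, e2, e3 u w, e3 v w, e3 u w', e4, e5]
  have := mul_le_mul_of_nonneg_left hle (Nat.cast_nonneg (α := ℝ) (w v))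
  linarith

/-- If two nonadjacent vertices cannot be covered by a common maximal induced matching, then the
bound for smaller vertex sets implies the bound for `S`. -/
theorem weightedCount_mul_le_of_not_both (hu : u ∈ S) (hv : v ∈ S) (huv : u ≠ v)
    (hw : ∀ x, 0 < w x) (h : ∀ C ∈ coverFamily G S, u ∈ C → v ∉ C)
    (ih : ∀ T ⊂ S, ∀ w : V → ℕ, (∀ x, 0 < w x) →
      weightedCount G w T ∅ * rho ^ (∑ i ∈ T, w i) ≤ 1) :
    weightedCount G w S ∅ * rho ^ (∑ i ∈ S, w i) ≤ 1 := by
  wlog hle : ∑ C ∈ coverFamily G S with v ∈ C, ∏ i ∈ C.erase v, (w i : ℝ) ≤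
      ∑ C ∈ coverFamily G S with u ∈ C, ∏ i ∈ C.erase u, (w i : ℝ) generalizing u v
  · exact this hv hu huv.symm (fun C hC hv hu => h C hC hu hv) (le_of_not_ge hle)
  have h1 := weightedCount_le_update huv h hle
  have h2 := ih (S.erase v) (Finset.erase_ssubset hv) (Function.update w u (w u + w v)) fun x => by
    by_cases hx : x = u
    · subst hx; simp [hw]
    · simp [hx, hw]
  have h3 : ∑ i ∈ S.erase v, Function.update w u (w u + w v) i = ∑ i ∈ S, w i := by
    have hu' : u ∈ S.erase v := Finset.mem_erase.2 ⟨huv, hu⟩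
    rw [Finset.sum_update_of_mem hu', ← Finset.add_sum_erase S w hv,
      ← Finset.add_sum_erase _ w hu', Finset.sdiff_singleton_eq_erase]
    omega
  rw [h3] at h2
  exact (mul_le_mul_of_nonneg_right h1 (pow_pos rho_pos _).le).trans h2

theorem weightedCount_sdiff_mul_le (hX : X ⊆ S) (hne : X.Nonempty)
    (hw : ∀ x, 0 < w x) (ih : ∀ T ⊂ S, ∀ w : V → ℕ, (∀ x, 0 < w x) →
      weightedCount G w T ∅ * rho ^ (∑ i ∈ T, w i) ≤ 1) :
    weightedCount G w (S \ X) ∅ * rho ^ (∑ i ∈ S, w i) ≤ rho ^ (∑ i ∈ X, w i) := by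
  have h := ih (S \ X) (Finset.sdiff_ssubset hX hne) w hw
  rw [← Finset.sum_sdiff hX, pow_add, ← mul_assoc]
  simpa using mul_le_mul_of_nonneg_right h (pow_pos rho_pos (∑ i ∈ X, w i)).le

open scoped Classical in
/-- The bound for `S` follows from the bound for smaller vertex sets when all pairs of nonadjacent
vertices have private neighbours that are nonadjacent. -/
theorem weightedCount_mul_le_of_separated (hG : G.CliqueFree 3) (hS : S.Nonempty)
    (hw : ∀ x, 0 < w x) (ih : ∀ T ⊂ S, ∀ w : V → ℕ, (∀ x, 0 < w x) →
      weightedCount G w T ∅ * rho ^ (∑ i ∈ T, w i) ≤ 1)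
    (hsep : ∀ u ∈ S, ∀ v ∈ S, u ≠ v → ¬ G.Adj u v → ∃ s ∈ S, G.Adj u s ∧ ∃ t ∈ S, G.Adj v t ∧
      s ≠ t ∧ ¬ G.Adj v s ∧ ¬ G.Adj u t ∧ ¬ G.Adj t s) :
    weightedCount G w S ∅ * rho ^ (∑ i ∈ S, w i) ≤ 1 := by
  set ι : {x // x ∈ S} ↪ V := Function.Embedding.subtype _
  have hι : ∀ U : Finset {x // x ∈ S}, U.map ι ⊆ S := by
    intro U x hx
    obtain ⟨y, -, rfl⟩ := Finset.mem_map.1 hx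
    exact y.2
  have hsum : ∀ U : Finset {x // x ∈ S}, ∑ i ∈ U.map ι, w i = ∑ i ∈ U, w i :=
    fun U => Finset.sum_map _ _ _
  have hρ : 0 ≤ rho ^ (∑ i ∈ S, w i) := (pow_pos rho_pos _).le
  let N : {x // x ∈ S} → Finset {x // x ∈ S} := fun v => {u | G.Adj v u}
  have hN : ∀ u v, u ∈ N v ↔ G.Adj v u := fun u v => by simp [N]
  let B : BranchSystem {x // x ∈ S} :=
    { N := N
      w := fun v => w v
      m := fun U => weightedCount G w S (U.map ι) * rho ^ (∑ i ∈ S, w i)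
      symm := fun u v h => (hN _ _).2 ((hN _ _).1 h).symm
      triangle := fun u v z h₁ h₂ h₃ => by
        rw [hN] at h₁ h₂ h₃
        exact hG {v.1, u.1, z.1} (SimpleGraph.is3Clique_triple_iff.2 ⟨h₁, h₃, h₂⟩)
      w_pos := fun v => hw v
      separated := fun u v huv h => by
        rw [hN] at h
        obtain ⟨s, hs, hus, t, ht, hvt, h₁, h₂, h₃, h₄⟩ :=
          hsep u u.2 v v.2 (fun h => huv (Subtype.ext h)) h
        refine ⟨⟨s, hs⟩, (hN _ _).2 hus, ⟨t, ht⟩, (hN _ _).2 hvt, ?_⟩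
        simp only [hN]
        exact ⟨fun h => h₁ (congrArg Subtype.val h), h₂, h₃, h₄⟩
      branch := fun v U => by
        have h := weightedCount_branch (G := G) (w := w) (S := S) (v := (v : V)) (U := U.map ι)
          ((N v \ U).map ι) (fun u hu hvu huU => Finset.mem_map.2 ⟨⟨u, hu⟩, Finset.mem_sdiff.2
            ⟨(hN _ _).2 hvu, fun hU => huU (Finset.mem_map_of_mem ι hU)⟩, rfl⟩)
          (fun u hu => by
            obtain ⟨y, hy, rfl⟩ := Finset.mem_map.1 hu
            exact (hN _ _).1 (Finset.mem_sdiff.1 hy).1)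
          (fun u => {x ∈ S | G.Adj u x ∨ G.Adj v x ∨ x ∈ U.map ι})
          (fun u _ x => Finset.mem_filter)
        rw [Finset.map_insert]
        refine (mul_le_mul_of_nonneg_right h hρ).trans ?_
        rw [add_mul, Finset.sum_map, Finset.sum_mul]
        refine add_le_add le_rfl (Finset.sum_le_sum fun u hu => ?_)
        have hX : ({x ∈ S | G.Adj u x ∨ G.Adj v x ∨ x ∈ U.map ι} : Finset V) =
            (N u ∪ N v ∪ U).map ι := by
          ext x
          simp only [Finset.mem_filter, Finset.mem_map, Finset.mem_union, hN, ι,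
            Function.Embedding.subtype_apply, Subtype.exists, exists_and_right, exists_eq_right]
          constructor
          · rintro ⟨hx, h | h | ⟨_, h⟩⟩
            · exact ⟨hx, Or.inl (Or.inl h)⟩
            · exact ⟨hx, Or.inl (Or.inr h)⟩
            · exact ⟨hx, Or.inr h⟩
          · rintro ⟨hx, (h | h) | h⟩
            · exact ⟨hx, Or.inl h⟩
            · exact ⟨hx, Or.inr (Or.inl h)⟩
            · exact ⟨hx, Or.inr (Or.inr ⟨hx, h⟩)⟩
        have hne : ((N u ∪ N v ∪ U).map ι).Nonempty := by
          refine ⟨u, Finset.mem_map_of_mem ι ?_⟩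
          simp [(Finset.mem_sdiff.1 hu).1]
        have h₂ := weightedCount_sdiff_mul_le (G := G) (hι _) hne hw ih
        rw [hsum, ← hX] at h₂
        rw [mul_assoc]
        exact mul_le_mul_of_nonneg_left h₂ (by positivity)
      blocked := fun u v U huv hu hv => by
        rw [weightedCount_eq_zero ((hN _ _).1 huv).symm u.2 v.2, zero_mul]
        · exact fun x hx hxu => Finset.mem_map_of_mem ι (hu ((hN ⟨x, hx⟩ u).2 hxu.symm))
        · exact fun x hx hxv => Finset.mem_map_of_mem ι (hv ((hN ⟨x, hx⟩ v).2 hxv.symm))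
      bound := fun U hU => by
        rw [← hsum]
        exact (mul_le_mul_of_nonneg_right weightedCount_le_sdiff hρ).trans
          (weightedCount_sdiff_mul_le (hι U) (hU.map) hw ih) }
  obtain ⟨x, hx⟩ := hS
  simpa [B] using B.m_empty_le_one ⟨x, hx⟩

theorem weightedCount_mul_le (hG : G.CliqueFree 3) (S : Finset V) :
    ∀ w : V → ℕ, (∀ x, 0 < w x) → weightedCount G w S ∅ * rho ^ (∑ i ∈ S, w i) ≤ 1 := by
  induction S using Finset.strongInduction with
  | H S ih =>
    intro w hw
    rcases S.eq_empty_or_nonempty with rfl | hS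
    · have : coverFamily G ∅ = {∅} := by
        ext C
        simp only [mem_coverFamily, Finset.mem_singleton, Finset.subset_empty]
        exact ⟨And.left, by rintro rfl; simp⟩
      simp [weightedCount, this]
    by_cases hsep : ∀ u ∈ S, ∀ v ∈ S, u ≠ v → ¬ G.Adj u v → ∃ s ∈ S, G.Adj u s ∧
        ∃ t ∈ S, G.Adj v t ∧ s ≠ t ∧ ¬ G.Adj v s ∧ ¬ G.Adj u t ∧ ¬ G.Adj t s
    · exact weightedCount_mul_le_of_separated hG hS hw ih hsep
    push Not at hsep
    obtain ⟨u, hu, v, hv, huv, huv', h⟩ := hsep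
    refine weightedCount_mul_le_of_not_both hu hv huv hw (fun C hC huC hvC => ?_) ih
    obtain ⟨hCS, hC₁, -⟩ := mem_coverFamily.1 hC
    obtain ⟨s, ⟨hs, hus⟩, -⟩ := hC₁ u huC
    obtain ⟨t, ⟨ht, hvt⟩, -⟩ := hC₁ v hvC
    have hvs : ¬ G.Adj v s := fun h => huv (eq_of_mem_coverFamily hC hs huC hvC hus.symm h.symm)
    have hut : ¬ G.Adj u t := fun h => huv (eq_of_mem_coverFamily hC ht huC hvC h.symm hvt.symm)
    have hts := h s (hCS hs) hus t (hCS ht) hvt (by rintro rfl; exact hvs hvt) hvs hut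
    obtain rfl := eq_of_mem_coverFamily hC hs ht huC hts.symm hus.symm
    exact huv' hvt.symm

end Graph

section Matching

variable {V : Type*} {G : SimpleGraph V} {M M' : Finset (Sym2 V)} {u v : V}

theorem exists_partner (hM : IsInducedMatching G M) (hv : MCovers M v) :
    ∃ u, MCovers M u ∧ G.Adj v u ∧ ∀ x, MCovers M x → G.Adj v x → x = u := by
  obtain ⟨e, he, hve⟩ := hv
  obtain ⟨u, rfl⟩ := Sym2.mem_iff_exists.1 hve
  refine ⟨u, ⟨_, he, Sym2.mem_mk_right v u⟩, hM.1 _ he, ?_⟩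
  rintro x ⟨f, hf, hxf⟩ hvx
  by_cases hfe : s(v, u) = f
  · subst hfe
    exact (Sym2.mem_iff.1 hxf).resolve_left hvx.ne'
  · exact absurd hvx (hM.2 _ he _ hf hfe v hve x hxf).2

theorem mem_iff_mCovers (hM : IsInducedMatching G M) {e : Sym2 V} :
    e ∈ M ↔ e ∈ G.edgeSet ∧ ∀ x ∈ e, MCovers M x := by
  refine ⟨fun he => ⟨hM.1 e he, fun x hx => ⟨e, he, hx⟩⟩, fun ⟨he, h⟩ => ?_⟩
  induction e with
  | _ a b =>
    obtain ⟨f, hf, haf⟩ := h a (Sym2.mem_mk_left a b)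
    obtain ⟨g, hg, hbg⟩ := h b (Sym2.mem_mk_right a b)
    have hab : G.Adj a b := he
    by_cases hfg : f = g
    · subst hfg
      rwa [← (Sym2.mem_and_mem_iff hab.ne).1 ⟨haf, hbg⟩]
    · exact absurd hab (hM.2 f hf g hg hfg a haf b hbg).2

theorem eq_of_mCovers_iff (hM : IsInducedMatching G M) (hM' : IsInducedMatching G M')
    (h : ∀ x, MCovers M x ↔ MCovers M' x) : M = M' := by
  ext e
  simp only [mem_iff_mCovers hM, mem_iff_mCovers hM', h]

theorem exists_mCovers_adj (hM : IsMaximalInducedMatching G M) (huv : G.Adj u v) :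
    ∃ c, MCovers M c ∧ (G.Adj c u ∨ G.Adj c v) := by
  classical
  by_contra! h
  have hfar : ∀ f ∈ M, ∀ x ∈ s(u, v), ∀ y ∈ f, x ≠ y ∧ ¬ G.Adj x y := by
    intro f hf x hx y hy
    have hadj : ∀ c, MCovers M c → ¬ G.Adj x c := by
      intro c hc hxc
      rcases Sym2.mem_iff.1 hx with rfl | rfl
      · exact (h c hc).1 hxc.symm
      · exact (h c hc).2 hxc.symm
    refine ⟨?_, hadj y ⟨f, hf, hy⟩⟩
    rintro rfl
    obtain ⟨z, hz, hxz, -⟩ := exists_partner hM.1 ⟨f, hf, hy⟩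
    exact hadj z hz hxz
  have hins : IsInducedMatching G (insert s(u, v) M) := by
    constructor
    · intro e he
      rcases Finset.mem_insert.1 he with rfl | he
      · exact huv
      · exact hM.1.1 e he
    · intro e he f hf hef x hx y hy
      rcases Finset.mem_insert.1 he with rfl | he <;> rcases Finset.mem_insert.1 hf with rfl | hf
      · exact absurd rfl hef
      · exact hfar f hf x hx y hy
      · have := hfar e he y hy x hx
        exact ⟨this.1.symm, fun h => this.2 h.symm⟩
      · exact hM.1.2 e he f hf hef x hx y hy
  have hmem : s(u, v) ∈ M := by
    rw [← hM.2 _ hins (Finset.subset_insert _ _)]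
    exact Finset.mem_insert_self _ _
  exact (h v ⟨_, hmem, Sym2.mem_mk_right u v⟩).1 huv.symm

theorem mimCount_le_card_coverFamily [Fintype V] [DecidableEq V] (G : SimpleGraph V) :
    mimCount G ≤ #(coverFamily G univ) := by
  classical
  rw [mimCount, ← Set.ncard_coe_finset]
  refine Set.ncard_le_ncard_of_injOn (fun M => ({v | MCovers M v} : Finset V)) ?_ ?_
    (Finset.finite_toSet _)
  · intro M (hM : IsMaximalInducedMatching G M)
    refine mem_coverFamily.2 ⟨Finset.subset_univ _, fun v hv => ?_, fun u _ v _ huv => ?_⟩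
    · obtain ⟨u, hu, hvu, huniq⟩ := exists_partner hM.1 (Finset.mem_filter.1 hv).2
      exact ⟨u, ⟨by simpa using hu, hvu⟩, fun x hx => huniq x (by simpa using hx.1) hx.2⟩
    · obtain ⟨c, hc, h⟩ := exists_mCovers_adj hM huv
      exact ⟨c, by simpa using hc, h⟩
  · intro M hM M' hM' h
    exact eq_of_mCovers_iff hM.1 hM'.1 fun x => by
      simpa using congrArg (fun C : Finset V => x ∈ C) h

end Matching

end InducedMatching

/-- Every triangle-free graph on `n` vertices has at most `3^(n/3)` maximal
induced matchings (stated as: the cube of the count is at most `3^n`). -/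
theorem mimCount_le_of_triangleFree {V : Type*} [Fintype V] (G : SimpleGraph V)
    (hG : G.CliqueFree 3) : (mimCount G) ^ 3 ≤ 3 ^ (Fintype.card V) := by
  classical
  have hcount : (mimCount G : ℝ) * InducedMatching.rho ^ Fintype.card V ≤ 1 := by
    have h := InducedMatching.weightedCount_mul_le hG Finset.univ (fun _ => 1) fun _ => one_pos
    rw [InducedMatching.weightedCount_empty_right] at h
    simp only [Nat.cast_one, Finset.prod_const_one, Finset.sum_const, nsmul_eq_mul, mul_one,
      Finset.card_univ, smul_eq_mul] at h
    have hle : (mimCount G : ℝ) ≤ (InducedMatching.coverFamily G Finset.univ).card :=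
      mod_cast InducedMatching.mimCount_le_card_coverFamily G
    exact (mul_le_mul_of_nonneg_right hle (pow_pos InducedMatching.rho_pos _).le).trans h
  have hcube := pow_le_one₀ (n := 3)
    (mul_nonneg (Nat.cast_nonneg _) (pow_pos InducedMatching.rho_pos _).le) hcount
  rw [mul_pow, ← pow_mul, mul_comm (Fintype.card V), pow_mul, InducedMatching.rho_pow_three,
    one_div, inv_pow, ← div_eq_mul_inv, div_le_one (by positivity)] at hcube
  exact_mod_cast hcube
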